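/- arXiv:0902.1872 — 5 statements merged into one kernel-verified Lean document; each statement's English description precedes it below -/
import Mathlib

section
/- Assume (H1) for i = 1, f₁(1) = q, and (H2). Then for every η > 0 there exists a nondecreasing function y : (-∞,0] → [φ₁(u₁^⋆), φ₁(1)], differentiable on (-∞,0) with y'(x) = f₁(φ₁^{-1}(y(x))) - q for all x < 0, such that y(x) = φ₁(1) for x ∈ [-η,0], y(x) < φ₁(1) for all x < -η, and lim_{x→-∞} y(x) = φ₁(u₁^⋆). -/
open MeasureTheory Set Filter

noncomputable section

/-- If `f` has derivative `g` on a punctured neighbourhood of `x`, and both `f` and `g` are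
continuous at `x`, then `f` has derivative `g x` at `x`. -/
theorem hasDerivAt_of_eventually_hasDerivAt_ne {f g : ℝ → ℝ} {x : ℝ}
    (hd : ∀ᶠ y in nhdsWithin x {x}ᶜ, HasDerivAt f (g y) y)
    (hf : ContinuousAt f x) (hg : ContinuousAt g x) : HasDerivAt f (g x) x := by
  have hr : {y | HasDerivAt f (g y) y} ∈ nhdsWithin x (Ioi x) :=
    nhdsWithin_mono x (fun y hy => ne_of_gt hy) hd
  have hl : {y | HasDerivAt f (g y) y} ∈ nhdsWithin x (Iio x) :=
    nhdsWithin_mono x (fun y hy => ne_of_lt hy) hd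
  have A : HasDerivWithinAt f (g x) (Ici x) x := by
    refine hasDerivWithinAt_Ici_of_tendsto_deriv
      (s := {y | HasDerivAt f (g y) y}) (fun y hy => ?_) hf.continuousWithinAt hr ?_
    · exact (HasDerivAt.differentiableAt hy).differentiableWithinAt
    · refine (hg.tendsto.mono_left nhdsWithin_le_nhds).congr' ?_
      filter_upwards [hr] with y hy
      exact (HasDerivAt.deriv hy).symm
  have B : HasDerivWithinAt f (g x) (Iic x) x := by
    refine hasDerivWithinAt_Iic_of_tendsto_deriv
      (s := {y | HasDerivAt f (g y) y}) (fun y hy => ?_) hf.continuousWithinAt hl ?_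
    · exact (HasDerivAt.differentiableAt hy).differentiableWithinAt
    · refine (hg.tendsto.mono_left nhdsWithin_le_nhds).congr' ?_
      filter_upwards [hl] with y hy
      exact (HasDerivAt.deriv hy).symm
  have := B.union A
  rwa [Iic_union_Ici, hasDerivWithinAt_univ] at this

/-- If `1 / k` is integrable near `0`, expressed through a primitive `T` of `1 / k` on `(0, L)`
that is continuous at `0`, then `z' = k z` has a solution leaving the equilibrium `0` at time `0`
and tending to the equilibrium `L`. -/
theorem exists_solution_of_travel_time {k T : ℝ → ℝ} {L : ℝ} (hL : 0 < L)
    (hk : ContinuousOn k (Icc 0 L)) (hk0 : k 0 = 0) (hkL : k L = 0)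
    (hkpos : ∀ w ∈ Ioo 0 L, 0 < k w) (hT0 : T 0 = 0) (hTc : ContinuousOn T (Ico 0 L))
    (hTd : ∀ w ∈ Ioo 0 L, HasDerivAt T (k w)⁻¹ w) :
    ∃ z : ℝ → ℝ, Monotone z ∧ (∀ t, z t ∈ Icc 0 L) ∧ (∀ t, HasDerivAt z (k (z t)) t) ∧
      (∀ t ≤ 0, z t = 0) ∧ (∀ t, 0 < t → 0 < z t) ∧ Tendsto z atTop (nhds L) := by
  have hmono : StrictMonoOn T (Ico 0 L) := by
    refine strictMonoOn_of_deriv_pos (convex_Ico 0 L) hTc fun w hw => ?_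
    rw [interior_Ico] at hw
    rw [(hTd w hw).deriv]
    exact inv_pos.2 (hkpos w hw)
  set S : ℝ → Set ℝ := fun t => {w | w ∈ Ico 0 L ∧ T w ≤ t}
  set z : ℝ → ℝ := fun t => sSup (S t)
  have hbdd : ∀ t, BddAbove (S t) := fun t => ⟨L, fun w hw => hw.1.2.le⟩
  have hle : ∀ {w t}, w ∈ Ico 0 L → T w ≤ t → w ≤ z t := fun hw ht =>
    le_csSup (hbdd _) ⟨hw, ht⟩
  have hz0 : ∀ t, 0 ≤ z t := fun t => Real.sSup_nonneg fun w hw => hw.1.1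
  have hzL : ∀ t, z t ≤ L := fun t => Real.sSup_le (fun w hw => hw.1.2.le) hL.le
  have hge : ∀ {w t}, w ∈ Ico 0 L → t ≤ T w → z t ≤ w := fun {w t} hw ht =>
    Real.sSup_le (fun v hv => (hmono.le_iff_le hv.1 hw).1 (hv.2.trans ht)) hw.1
  have hzmono : Monotone z := fun s t hst => Real.sSup_le
    (fun v hv => hle hv.1 (hv.2.trans hst)) (hz0 t)
  have hlt : ∀ {w t}, 0 ≤ w → w < z t → T w < t := by
    intro w t hw hwt
    have hwL : w < L := hwt.trans_le (hzL t)
    by_contra! h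
    exact absurd (hge ⟨hw, hwL⟩ h) (not_le.2 hwt)
  have hcont : Continuous z := by
    refine continuous_iff_continuousAt.2 fun t => tendsto_order.2 ⟨fun c hc => ?_, fun c hc => ?_⟩
    · rcases lt_or_ge c 0 with h0 | h0
      · exact Eventually.of_forall fun s => h0.trans_le (hz0 s)
      · obtain ⟨w, hcw, hwt⟩ := exists_between hc
        filter_upwards [Ioi_mem_nhds (hlt (h0.trans hcw.le) hwt)] with s hs
        exact hcw.trans_le (hle ⟨h0.trans hcw.le, hwt.trans_le (hzL t)⟩ (le_of_lt hs))
    · rcases lt_or_ge L c with h0 | h0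
      · exact Eventually.of_forall fun s => (hzL s).trans_lt h0
      · obtain ⟨w, htw, hwc⟩ := exists_between hc
        have hw : w ∈ Ico 0 L := ⟨(hz0 t).trans htw.le, hwc.trans_le h0⟩
        have : t < T w := by
          by_contra! h
          exact absurd (hle hw h) (not_le.2 htw)
        filter_upwards [Iio_mem_nhds this] with s hs
        exact (hge hw (le_of_lt hs)).trans_lt hwc
  have hTz : ∀ t, z t ∈ Ioo 0 L → T (z t) = t := by
    intro t ht
    have hc : ContinuousAt T (z t) := (hTd _ ht).continuousAt
    refine le_antisymm ?_ ?_
    · refine le_of_tendsto (hc.tendsto.mono_left (nhdsWithin_le_nhds (s := Iio (z t)))) ?_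
      filter_upwards [Ioo_mem_nhdsLT ht.1] with w hw
      exact (hlt hw.1.le hw.2).le
    · refine ge_of_tendsto (hc.tendsto.mono_left (nhdsWithin_le_nhds (s := Ioi (z t)))) ?_
      filter_upwards [Ioo_mem_nhdsGT ht.2] with w hw
      by_contra! h
      exact absurd (hle ⟨ht.1.le.trans hw.1.le, hw.2⟩ h.le) (not_le.2 hw.1)
  have hneg : ∀ t ≤ 0, z t = 0 := fun t ht =>
    le_antisymm (hge ⟨le_rfl, hL⟩ (hT0.symm ▸ ht)) (hz0 t)
  have hpos : ∀ t, 0 < t → 0 < z t := by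
    intro t ht
    have hc : Tendsto T (nhdsWithin 0 (Ioo 0 L)) (nhds 0) := by
      have := (hTc 0 ⟨le_rfl, hL⟩).tendsto.mono_left (nhdsWithin_mono 0 Ioo_subset_Ico_self)
      rwa [hT0] at this
    rw [nhdsWithin_Ioo_eq_nhdsGT hL] at hc
    obtain ⟨w, hwt, hw⟩ :=
      ((hc.eventually (gt_mem_nhds ht)).and (Ioo_mem_nhdsGT hL)).exists
    exact hw.1.trans_le (hle ⟨hw.1.le, hw.2⟩ hwt.le)
  have hkz : Continuous fun t => k (z t) :=
    hk.comp_continuous hcont fun t => ⟨hz0 t, hzL t⟩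
  have hmid : ∀ t, z t ∈ Ioo 0 L → HasDerivAt z (k (z t)) t := by
    intro t ht
    have h := HasDerivAt.of_local_left_inverse hcont.continuousAt (hTd _ ht)
      (inv_ne_zero (hkpos _ ht).ne') ?_
    · rwa [inv_inv] at h
    · filter_upwards [hcont.continuousAt.preimage_mem_nhds (Ioo_mem_nhds ht.1 ht.2)] with s hs
      exact hTz s hs
  have hderivneg : ∀ t < 0, HasDerivAt z (k (z t)) t := by
    intro t ht
    rw [hneg t ht.le, hk0]
    refine (hasDerivAt_const t (0 : ℝ)).congr_of_eventuallyEq ?_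
    filter_upwards [Iio_mem_nhds ht] with s hs using hneg s (le_of_lt hs)
  have hderivtop : ∀ s t, s < t → z s = L → HasDerivAt z (k (z t)) t := by
    intro s t hst hs
    have hL' : ∀ r, s < r → z r = L := fun r hr =>
      le_antisymm (hzL r) (hs ▸ hzmono hr.le)
    rw [hL' t hst, hkL]
    refine (hasDerivAt_const t L).congr_of_eventuallyEq ?_
    filter_upwards [Ioi_mem_nhds hst] with r hr using hL' r hr
  refine ⟨z, hzmono, fun t => ⟨hz0 t, hzL t⟩, fun t => ?_, hneg, hpos, ?_⟩
  · rcases lt_trichotomy t 0 with ht | rfl | ht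
    · exact hderivneg t ht
    · refine hasDerivAt_of_eventually_hasDerivAt_ne (g := fun t => k (z t)) ?_
        hcont.continuousAt hkz.continuousAt
      have hsmall : ∀ᶠ s in nhdsWithin 0 {0}ᶜ, z s < L := nhdsWithin_le_nhds
        (hcont.continuousAt.eventually (gt_mem_nhds ((hneg 0 le_rfl).symm ▸ hL)))
      filter_upwards [hsmall, self_mem_nhdsWithin] with s hs hst
      rcases lt_or_gt_of_ne hst with h | h
      · exact hderivneg s h
      · exact hmid s ⟨hpos s h, hs⟩
    · rcases (hzL t).lt_or_eq with hLt | hLt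
      · exact hmid t ⟨hpos t ht, hLt⟩
      by_cases hex : ∃ s < t, z s = L
      · obtain ⟨s, hst, hs⟩ := hex
        exact hderivtop s t hst hs
      push Not at hex
      refine hasDerivAt_of_eventually_hasDerivAt_ne (g := fun t => k (z t)) ?_
        hcont.continuousAt hkz.continuousAt
      filter_upwards [nhdsWithin_le_nhds (Ioi_mem_nhds ht), self_mem_nhdsWithin] with s hs hst
      rcases lt_or_gt_of_ne hst with h | h
      · exact hmid s ⟨hpos s hs, lt_of_le_of_ne (hzL s) (hex s h)⟩
      · exact hderivtop t s h hLt
  · refine tendsto_order.2 ⟨fun c hc => ?_, fun c hc =>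
      Eventually.of_forall fun s => (hzL s).trans_lt hc⟩
    obtain ⟨w, hw, hwL⟩ := exists_between (max_lt hc hL)
    filter_upwards [eventually_ge_atTop (T w)] with s hs
    exact ((le_max_left c 0).trans_lt hw).trans_le
      (hle ⟨(le_max_right c 0).trans hw.le, hwL⟩ hs)

/-- If `k` is continuous, positive on `(0, L)` and bounded below by `R w ^ m` with `m < 1` near
`0`, then `1 / k` has a primitive on `(0, L)` that extends continuously to `0`. -/
theorem exists_travel_time {k : ℝ → ℝ} {L R α m : ℝ} (hL : 0 < L)
    (hk : ContinuousOn k (Icc 0 L)) (hkpos : ∀ w ∈ Ioo 0 L, 0 < k w)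
    (hR : 0 < R) (hα : 0 < α) (hm : m < 1) (hlow : ∀ w ∈ Icc 0 α, R * w ^ m ≤ k w) :
    ∃ T : ℝ → ℝ, T 0 = 0 ∧ ContinuousOn T (Ico 0 L) ∧
      ∀ w ∈ Ioo 0 L, HasDerivAt T (k w)⁻¹ w := by
  have hinv : ContinuousOn (fun w => (k w)⁻¹) (Ioo 0 L) :=
    (hk.mono Ioo_subset_Icc_self).inv₀ fun w hw => (hkpos w hw).ne'
  obtain ⟨δ, hδ0, hδ⟩ := exists_between (lt_min hα hL)
  have hδα : δ < α := hδ.trans_le (min_le_left _ _)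
  have hδL : δ < L := hδ.trans_le (min_le_right _ _)
  have hint0 : IntervalIntegrable (fun w => (k w)⁻¹) volume 0 δ := by
    have hb : IntervalIntegrable (fun w : ℝ => R⁻¹ * w ^ (-m)) volume 0 δ :=
      (intervalIntegral.intervalIntegrable_rpow' (by linarith)).const_mul _
    rw [intervalIntegrable_iff_integrableOn_Ioc_of_le hδ0.le] at hb ⊢
    have hsub : Ioc 0 δ ⊆ Ioo 0 L := fun w hw => ⟨hw.1, hw.2.trans_lt hδL⟩
    refine Integrable.mono' hb
      ((hinv.mono hsub).aestronglyMeasurable measurableSet_Ioc) ?_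
    filter_upwards [ae_restrict_mem measurableSet_Ioc] with w hw
    rw [Real.norm_of_nonneg (inv_pos.2 (hkpos w (hsub hw))).le, Real.rpow_neg hw.1.le,
      ← mul_inv]
    exact inv_anti₀ (mul_pos hR (Real.rpow_pos_of_pos hw.1 m))
      (hlow w ⟨hw.1.le, hw.2.trans hδα.le⟩)
  have hint : ∀ w ∈ Ioo 0 L, IntervalIntegrable (fun w => (k w)⁻¹) volume 0 w := by
    intro w hw
    refine hint0.trans (ContinuousOn.intervalIntegrable (hinv.mono ?_))
    exact ordConnected_Ioo.uIcc_subset ⟨hδ0, hδL⟩ hw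
  have hderiv : ∀ w ∈ Ioo 0 L, HasDerivAt (fun w => ∫ v in (0 : ℝ)..w, (k v)⁻¹) (k w)⁻¹ w :=
    fun w hw => intervalIntegral.integral_hasDerivAt_right (hint w hw)
      (hinv.stronglyMeasurableAtFilter isOpen_Ioo w hw)
      (hinv.continuousAt (isOpen_Ioo.mem_nhds hw))
  refine ⟨fun w => ∫ v in (0 : ℝ)..w, (k v)⁻¹, intervalIntegral.integral_same, ?_, hderiv⟩
  intro w hw
  rcases hw.1.eq_or_lt with rfl | h0
  · have hc := intervalIntegral.continuousOn_primitive_interval' hint0 left_mem_uIcc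
    rw [uIcc_of_le hδ0.le] at hc
    refine (hc 0 ⟨le_rfl, hδ0.le⟩).mono_of_mem_nhdsWithin ?_
    exact mem_of_superset (inter_mem_nhdsWithin _ (Iio_mem_nhds hδ0))
      fun v hv => ⟨hv.1.1, le_of_lt hv.2⟩
  · exact (hderiv w ⟨h0, hw.2⟩).continuousAt.continuousWithinAt

/-- Lemma 2.5: existence of a particular solution `y` of the ODE
`y' = f₁ ∘ φ₁⁻¹(y) - q` on `(-∞,0]`, nondecreasing, equal to `φ₁(1)` on `[-η,0]`,
strictly below `φ₁(1)` before `-η`, and tending to `φ₁(u₁⋆)` at `-∞`. -/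
theorem stmt8 (q Cc u1s R α m : ℝ) (g₁ f₁ φ φinv : ℝ → ℝ)
    (hq : 0 ≤ q) (hC : 0 < Cc)
    (hg₁l : ∃ K : NNReal, LipschitzOnWith K g₁ (Icc 0 1))
    (hg₁p : ∀ s ∈ Ioo (0:ℝ) 1, 0 < g₁ s) (hg₁0 : g₁ 0 = 0) (hg₁1 : g₁ 1 = 0)
    (hφ : ∀ s, φ s = Cc * ∫ r in (0:ℝ)..s, g₁ r)
    (hφmono : StrictMonoOn φ (Icc 0 1))
    (hφinv : ∀ s ∈ Icc (0:ℝ) (φ 1), φinv s ∈ Icc (0:ℝ) 1 ∧ φ (φinv s) = s)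
    (hφinv' : ∀ v ∈ Icc (0:ℝ) 1, φinv (φ v) = v)
    (hφinvcont : ContinuousOn φinv (Icc 0 (φ 1)))
    (hf₁l : ∃ K : NNReal, LipschitzOnWith K f₁ (Icc 0 1)) (hf₁1 : f₁ 1 = q)
    -- (H1) for i = 1
    (h1s : u1s ∈ Ico (0:ℝ) 1) (hf₁s : f₁ u1s = q)
    (hf₁mono : StrictMonoOn f₁ (Icc 0 u1s)) (hf₁gt : ∀ s ∈ Ioo u1s 1, q < f₁ s)
    -- (H2)
    (hR : 0 < R) (hα : 0 < α) (hm : m ∈ Ioo (0:ℝ) 1)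
    (hH2 : ∀ s ∈ Icc (φ 1 - α) (φ 1), q + R * (φ 1 - s) ^ m ≤ f₁ (φinv s)) :
    ∀ η : ℝ, 0 < η → ∃ y : ℝ → ℝ,
      MonotoneOn y (Iic 0) ∧
      (∀ x ≤ (0:ℝ), y x ∈ Icc (φ u1s) (φ 1)) ∧
      (∀ x < (0:ℝ), HasDerivAt y (f₁ (φinv (y x)) - q) x) ∧
      (∀ x ∈ Icc (-η) (0:ℝ), y x = φ 1) ∧
      (∀ x < -η, y x < φ 1) ∧
      Tendsto y atBot (nhds (φ u1s)) := by
  intro η hη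
  have hu : u1s ∈ Icc (0 : ℝ) 1 := ⟨h1s.1, h1s.2.le⟩
  have h1 : (1 : ℝ) ∈ Icc (0 : ℝ) 1 := ⟨zero_le_one, le_rfl⟩
  have hφ0 : φ 0 = 0 := by simp [hφ]
  have ha : 0 ≤ φ u1s := hφ0 ▸ hφmono.monotoneOn ⟨le_rfl, zero_le_one⟩ hu h1s.1
  have hab : φ u1s < φ 1 := hφmono hu h1 h1s.2
  have hL : 0 < φ 1 - φ u1s := sub_pos.2 hab
  set k : ℝ → ℝ := fun w => f₁ (φinv (φ 1 - w)) - q with hkdef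
  have hmaps : ∀ w ∈ Icc 0 (φ 1 - φ u1s), φ 1 - w ∈ Icc 0 (φ 1) := fun w hw =>
    ⟨by linarith [hw.2], by linarith [hw.1]⟩
  have hk : ContinuousOn k (Icc 0 (φ 1 - φ u1s)) := by
    obtain ⟨K, hK⟩ := hf₁l
    refine ContinuousOn.sub ?_ continuousOn_const
    refine hK.continuousOn.comp (hφinvcont.comp (by fun_prop) hmaps) fun w hw => ?_
    exact (hφinv _ (hmaps w hw)).1
  have hkpos : ∀ w ∈ Ioo 0 (φ 1 - φ u1s), 0 < k w := by
    intro w hw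
    obtain ⟨hv, hφv⟩ := hφinv _ (hmaps w ⟨hw.1.le, hw.2.le⟩)
    refine sub_pos.2 (hf₁gt _ ⟨(hφmono.lt_iff_lt hu hv).1 ?_, (hφmono.lt_iff_lt hv h1).1 ?_⟩)
    · rw [hφv]; linarith [hw.2]
    · rw [hφv]; linarith [hw.1]
  obtain ⟨T, hT0, hTc, hTd⟩ := exists_travel_time hL hk hkpos hR hα hm.2 fun w hw => by
    have h := hH2 (φ 1 - w) ⟨by linarith [hw.2], by linarith [hw.1]⟩
    rw [sub_sub_cancel] at h
    simp only [hkdef]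
    linarith
  obtain ⟨z, hzmono, hzmem, hzd, hzneg, hzpos, hzlim⟩ := exists_solution_of_travel_time hL hk
    (by simp [hkdef, hφinv' 1 h1, hf₁1]) (by simp [hkdef, hφinv' u1s hu, hf₁s])
    hkpos hT0 hTc hTd
  refine ⟨fun x => φ 1 - z (-η - x), ?_, ?_, ?_, ?_, ?_, ?_⟩
  · intro x _ x' _ hxx
    exact sub_le_sub_left (hzmono (by linarith)) _
  · intro x _
    have h := hzmem (-η - x)
    exact ⟨by linarith [h.2], by linarith [h.1]⟩
  · intro x _
    have h := ((hzd (-η - x)).comp_const_sub (-η) x).const_sub (φ 1)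
    rwa [neg_neg] at h
  · intro x hx
    simp [hzneg (-η - x) (by linarith [hx.1])]
  · intro x hx
    exact sub_lt_self _ (hzpos _ (by linarith))
  · have h : Tendsto (fun x : ℝ => -η - x) atBot atTop :=
      tendsto_atTop_add_const_left _ _ tendsto_neg_atBot_atTop
    simpa using (hzlim.comp h).const_sub (φ 1)
end
end

section
/- Assume (H1) for i = 2 and f₂(1) = q. Then for every η > 0 there exists a nondecreasing function z : ℝ → [φ₂(u₂^⋆), φ₂(1)], differentiable with z'(x) = f₂(φ₂^{-1}(z(x))) - q for all x ∈ ℝ, such that z(x) ≤ φ₂((1+u₂^⋆)/2) for x ≤ η, z(x) ≥ φ₂((1+u₂^⋆)/2) for x ≥ η, lim_{x→-∞} z(x) = φ₂(u₂^⋆) and lim_{x→+∞} z(x) = φ₂(1). -/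
open MeasureTheory Set Filter

noncomputable section

open scoped Topology

/-- A strictly increasing real function on an open interval has a monotone left inverse defined
on all of `ℝ`, with values in the closed interval. -/
theorem exists_monotone_leftInverse_of_strictMonoOn_Ioo {a b : ℝ} (hab : a < b) {T : ℝ → ℝ}
    (hT : StrictMonoOn T (Ioo a b)) :
    ∃ z : ℝ → ℝ, Monotone z ∧ (∀ x, z x ∈ Icc a b) ∧ ∀ y ∈ Ioo a b, z (T y) = y := by
  have hbdd (x : ℝ) : BddAbove (insert a {y | y ∈ Ioo a b ∧ T y ≤ x}) := by
    refine ⟨b, ?_⟩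
    rintro y (rfl | hy)
    exacts [hab.le, hy.1.2.le]
  refine ⟨fun x => sSup (insert a {y | y ∈ Ioo a b ∧ T y ≤ x}), fun x x' hx => ?_,
    fun x => ⟨le_csSup (hbdd x) (mem_insert _ _), csSup_le (insert_nonempty _ _) ?_⟩,
    fun y hy => le_antisymm (csSup_le (insert_nonempty _ _) ?_)
      (le_csSup (hbdd _) (mem_insert_of_mem _ ⟨hy, le_rfl⟩))⟩
  · exact csSup_le_csSup (hbdd x') (insert_nonempty _ _)
      (insert_subset_insert fun y hy => ⟨hy.1, hy.2.trans hx⟩)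
  · rintro y (rfl | hy)
    exacts [hab.le, hy.1.2.le]
  · rintro y' (rfl | hy')
    exacts [hy.1.le, (hT.le_iff_le hy'.1 hy).1 hy'.2]

section MonotoneLeftInverse

variable {a b : ℝ} {T z : ℝ → ℝ}

theorem lt_of_lt_leftInverse (hz : Monotone z) (hinv : ∀ y ∈ Ioo a b, z (T y) = y) {x y : ℝ}
    (hy : y ∈ Ioo a b) (h : y < z x) : T y < x := by
  by_contra! hx
  exact (h.trans_le (hz hx)).ne (hinv y hy).symm

theorem lt_of_leftInverse_lt (hz : Monotone z) (hinv : ∀ y ∈ Ioo a b, z (T y) = y) {x y : ℝ}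
    (hy : y ∈ Ioo a b) (h : z x < y) : x < T y := by
  by_contra! hx
  exact ((hz hx).trans_lt h).ne (hinv y hy)

theorem continuous_of_monotone_leftInverse (hz : Monotone z) (hmem : ∀ x, z x ∈ Icc a b)
    (hinv : ∀ y ∈ Ioo a b, z (T y) = y) : Continuous z := by
  refine continuous_iff_continuousAt.2 fun x => tendsto_order.2 ⟨fun l hl => ?_, fun u hu => ?_⟩
  · rcases lt_or_ge l a with hla | hla
    · exact Eventually.of_forall fun y => hla.trans_le (hmem y).1
    · obtain ⟨y, hly, hyx⟩ := exists_between hl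
      have hy : y ∈ Ioo a b := ⟨hla.trans_lt hly, hyx.trans_le (hmem x).2⟩
      filter_upwards [Ioi_mem_nhds (lt_of_lt_leftInverse hz hinv hy hyx)] with t ht
      exact hly.trans_le ((hinv y hy).symm.le.trans (hz (le_of_lt ht)))
  · rcases lt_or_ge b u with hbu | hbu
    · exact Eventually.of_forall fun y => (hmem y).2.trans_lt hbu
    · obtain ⟨y, hxy, hyu⟩ := exists_between hu
      have hy : y ∈ Ioo a b := ⟨(hmem x).1.trans_lt hxy, hyu.trans_le hbu⟩
      filter_upwards [Iio_mem_nhds (lt_of_leftInverse_lt hz hinv hy hxy)] with t ht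
      exact ((hz (le_of_lt ht)).trans (hinv y hy).le).trans_lt hyu

theorem rightInverse_of_monotone_leftInverse (hz : Monotone z)
    (hinv : ∀ y ∈ Ioo a b, z (T y) = y) {x : ℝ} (hx : z x ∈ Ioo a b)
    (hT : ContinuousAt T (z x)) : T (z x) = x := by
  have hIoo := Ioo_mem_nhds hx.1 hx.2
  refine le_antisymm (le_of_tendsto (hT.tendsto.mono_left nhdsWithin_le_nhds : Tendsto T
    (𝓝[<] (z x)) _) ?_) (ge_of_tendsto (hT.tendsto.mono_left nhdsWithin_le_nhds : Tendsto T
    (𝓝[>] (z x)) _) ?_)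
  · filter_upwards [self_mem_nhdsWithin, mem_nhdsWithin_of_mem_nhds hIoo] with y hy hy'
    exact (lt_of_lt_leftInverse hz hinv hy' hy).le
  · filter_upwards [self_mem_nhdsWithin, mem_nhdsWithin_of_mem_nhds hIoo] with y hy hy'
    exact (lt_of_leftInverse_lt hz hinv hy' hy).le

theorem tendsto_atTop_of_monotone_leftInverse (hab : a < b) (hz : Monotone z)
    (hmem : ∀ x, z x ∈ Icc a b) (hinv : ∀ y ∈ Ioo a b, z (T y) = y) :
    Tendsto z atTop (𝓝 b) := by
  refine tendsto_order.2 ⟨fun l hl => ?_,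
    fun u hu => Eventually.of_forall fun x => (hmem x).2.trans_lt hu⟩
  obtain ⟨y, hly, hyb⟩ := exists_between (max_lt hl hab)
  have hy : y ∈ Ioo a b := ⟨(le_max_right _ _).trans_lt hly, hyb⟩
  filter_upwards [eventually_ge_atTop (T y)] with x hx
  exact ((le_max_left _ _).trans_lt hly).trans_le ((hinv y hy).symm.le.trans (hz hx))

theorem tendsto_atBot_of_monotone_leftInverse (hab : a < b) (hz : Monotone z)
    (hmem : ∀ x, z x ∈ Icc a b) (hinv : ∀ y ∈ Ioo a b, z (T y) = y) :
    Tendsto z atBot (𝓝 a) := by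
  refine tendsto_order.2 ⟨fun l hl => Eventually.of_forall fun x => hl.trans_le (hmem x).1,
    fun u hu => ?_⟩
  obtain ⟨y, hay, hyu⟩ := exists_between (lt_min hu hab)
  have hy : y ∈ Ioo a b := ⟨hay, hyu.trans_le (min_le_right _ _)⟩
  filter_upwards [eventually_le_atBot (T y)] with x hx
  exact ((hz hx).trans (hinv y hy).le).trans_lt (hyu.trans_le (min_le_left _ _))

end MonotoneLeftInverse

/-- A monotone function that reaches its upper bound `b` at `x`, and whose derivative below the
level `b` tends to `0`, is differentiable at `x`. -/
theorem hasDerivAt_zero_of_monotone_of_eq_upperBound {z G : ℝ → ℝ} {b x : ℝ} (hz : Monotone z)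
    (hzc : ContinuousAt z x) (hzb : ∀ y, z y ≤ b) (hG : ContinuousAt G x) (hGx : G x = 0)
    (hder : ∀ᶠ y in 𝓝 x, z y < b → HasDerivAt z (G y) y) (hx : z x = b) :
    HasDerivAt z 0 x := by
  have htop {y t : ℝ} (hy : z y = b) (ht : y ≤ t) : z t = b :=
    le_antisymm (hzb t) (hy.symm.le.trans (hz ht))
  have hright : HasDerivWithinAt z 0 (Ici x) x :=
    (hasDerivWithinAt_const x (Ici x) b).congr (fun t ht => htop hx ht) hx
  suffices hleft : HasDerivWithinAt z 0 (Iic x) x by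
    simpa only [Iic_union_Ici, hasDerivWithinAt_univ] using hleft.union hright
  by_cases hex : ∃ y < x, z y = b
  · obtain ⟨y, hyx, hy⟩ := hex
    refine HasDerivAt.hasDerivWithinAt ((hasDerivAt_const x b).congr_of_eventuallyEq ?_)
    filter_upwards [Ioi_mem_nhds hyx] with t ht using htop hy (le_of_lt ht)
  · push Not at hex
    have hder' : ∀ᶠ y in 𝓝[<] x, HasDerivAt z (G y) y := by
      filter_upwards [mem_nhdsWithin_of_mem_nhds hder, self_mem_nhdsWithin] with y hy hyx
      exact hy ((hzb y).lt_of_ne (hex y hyx))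
    refine hasDerivWithinAt_Iic_of_tendsto_deriv (s := {y | HasDerivAt z (G y) y})
      (fun y hy => HasDerivAt.differentiableAt hy |>.differentiableWithinAt)
      hzc.continuousWithinAt hder' ?_
    refine Tendsto.congr' (f₁ := G) ?_ (hGx ▸ hG.tendsto.mono_left nhdsWithin_le_nhds)
    filter_upwards [hder'] with y hy using hy.deriv.symm

/-- The counterpart of `hasDerivAt_zero_of_monotone_of_eq_upperBound` for a lower bound. -/
theorem hasDerivAt_zero_of_monotone_of_eq_lowerBound {z G : ℝ → ℝ} {a x : ℝ} (hz : Monotone z)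
    (hzc : ContinuousAt z x) (hza : ∀ y, a ≤ z y) (hG : ContinuousAt G x) (hGx : G x = 0)
    (hder : ∀ᶠ y in 𝓝 x, a < z y → HasDerivAt z (G y) y) (hx : z x = a) :
    HasDerivAt z 0 x := by
  have hneg : Tendsto (fun y : ℝ => -y) (𝓝 (-x)) (𝓝 x) := by
    simpa using (continuous_neg.tendsto (-x) : Tendsto (fun y : ℝ => -y) _ _)
  have key : HasDerivAt (fun y => -z (-y)) 0 (-x) := by
    refine hasDerivAt_zero_of_monotone_of_eq_upperBound (G := fun y => G (-y)) (b := -a)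
      (fun s t hst => neg_le_neg (hz (neg_le_neg hst))) ?_ (fun y => neg_le_neg (hza _)) ?_
      (by simpa using hGx) ?_ (by simpa using hx)
    · simpa [ContinuousAt] using (hzc.tendsto.comp hneg).neg
    · simpa [ContinuousAt, Function.comp_def] using hG.tendsto.comp hneg
    · filter_upwards [hneg.eventually hder] with y hy hlt
      simpa [Function.comp_def] using
        ((hy (neg_lt_neg_iff.1 hlt)).scomp y (hasDerivAt_neg y)).fun_neg
  simpa [Function.comp_def] using (key.scomp x (hasDerivAt_neg x)).fun_neg

/-- The autonomous equation `z' = F z`, with `F` continuous on `[a, b]`, vanishing at the endpoints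
and positive in between, has a monotone solution joining `a` to `b` and passing through a prescribed
intermediate value `m` at a prescribed time `η`. -/
theorem exists_monotone_heteroclinic {a b m : ℝ} {F : ℝ → ℝ} (hm : m ∈ Ioo a b)
    (hF : ContinuousOn F (Icc a b)) (hFa : F a = 0) (hFb : F b = 0)
    (hFpos : ∀ y ∈ Ioo a b, 0 < F y) (η : ℝ) :
    ∃ z : ℝ → ℝ, Monotone z ∧ (∀ x, z x ∈ Icc a b) ∧ (∀ x, HasDerivAt z (F (z x)) x) ∧
      z η = m ∧ Tendsto z atBot (𝓝 a) ∧ Tendsto z atTop (𝓝 b) := by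
  have hab : a < b := hm.1.trans hm.2
  have hcont : ContinuousOn (fun s => (F s)⁻¹) (Ioo a b) :=
    (hF.mono Ioo_subset_Icc_self).inv₀ fun y hy => (hFpos y hy).ne'
  let T : ℝ → ℝ := fun y => η + ∫ s in m..y, (F s)⁻¹
  have hTder (y : ℝ) (hy : y ∈ Ioo a b) : HasDerivAt T (F y)⁻¹ y :=
    (intervalIntegral.integral_hasDerivAt_right
      (hcont.mono (ordConnected_Ioo.uIcc_subset hm hy)).intervalIntegrable
      (hcont.stronglyMeasurableAtFilter isOpen_Ioo y hy)
      (hcont.continuousAt (isOpen_Ioo.mem_nhds hy))).const_add η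
  have hT : StrictMonoOn T (Ioo a b) := by
    refine strictMonoOn_of_deriv_pos (convex_Ioo a b)
      (fun y hy => (hTder y hy).continuousAt.continuousWithinAt) fun y hy => ?_
    rw [interior_Ioo] at hy
    rw [(hTder y hy).deriv]
    exact inv_pos.2 (hFpos y hy)
  obtain ⟨z, hz, hmem, hinv⟩ := exists_monotone_leftInverse_of_strictMonoOn_Ioo hab hT
  have hzc := continuous_of_monotone_leftInverse hz hmem hinv
  have hFz : Continuous fun x => F (z x) := hF.comp_continuous hzc hmem
  have hder (x : ℝ) (hx : z x ∈ Ioo a b) : HasDerivAt z (F (z x)) x := by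
    have := HasDerivAt.of_local_left_inverse (f := T) hzc.continuousAt (hTder _ hx)
      (inv_ne_zero (hFpos _ hx).ne') <| by
        filter_upwards [hzc.continuousAt.preimage_mem_nhds (isOpen_Ioo.mem_nhds hx)] with y hy
        exact rightInverse_of_monotone_leftInverse hz hinv hy (hTder _ hy).continuousAt
    rwa [inv_inv] at this
  refine ⟨z, hz, hmem, fun x => ?_, ?_, tendsto_atBot_of_monotone_leftInverse hab hz hmem hinv,
    tendsto_atTop_of_monotone_leftInverse hab hz hmem hinv⟩
  · rcases (hmem x).1.eq_or_lt with hxa | hxa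
    · rw [← hxa, hFa]
      refine hasDerivAt_zero_of_monotone_of_eq_lowerBound hz hzc.continuousAt (fun y => (hmem y).1)
        hFz.continuousAt (by rw [← hxa, hFa]) ?_ hxa.symm
      filter_upwards [hzc.continuousAt.eventually_lt_const (hxa ▸ hab)] with y hy hy'
      exact hder y ⟨hy', hy⟩
    rcases (hmem x).2.eq_or_lt with hxb | hxb
    · rw [hxb, hFb]
      refine hasDerivAt_zero_of_monotone_of_eq_upperBound hz hzc.continuousAt (fun y => (hmem y).2)
        hFz.continuousAt (by rw [hxb, hFb]) ?_ hxb
      filter_upwards [hzc.continuousAt.eventually_const_lt hxa] with y hy hy'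
      exact hder y ⟨hy, hy'⟩
    · exact hder x ⟨hxa, hxb⟩
  · simpa [T] using hinv m hm

/-- Lemma 2.6: existence of a particular solution `z` of the ODE
`z' = f₂ ∘ φ₂⁻¹(z) - q` on `ℝ`, nondecreasing, crossing the level
`φ₂((1+u₂⋆)/2)` at `x = η`, and connecting `φ₂(u₂⋆)` at `-∞` to `φ₂(1)` at `+∞`. -/
theorem stmt10 (q Cc u2s : ℝ) (g₂ f₂ φ φinv : ℝ → ℝ)
    (hq : 0 ≤ q) (hC : 0 < Cc)
    (hg₂l : ∃ K : NNReal, LipschitzOnWith K g₂ (Icc 0 1))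
    (hg₂p : ∀ s ∈ Ioo (0:ℝ) 1, 0 < g₂ s) (hg₂0 : g₂ 0 = 0) (hg₂1 : g₂ 1 = 0)
    (hφ : ∀ s, φ s = Cc * ∫ r in (0:ℝ)..s, g₂ r)
    (hφmono : StrictMonoOn φ (Icc 0 1))
    (hφinv : ∀ s ∈ Icc (0:ℝ) (φ 1), φinv s ∈ Icc (0:ℝ) 1 ∧ φ (φinv s) = s)
    (hφinv' : ∀ v ∈ Icc (0:ℝ) 1, φinv (φ v) = v)
    (hφinvcont : ContinuousOn φinv (Icc 0 (φ 1)))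
    (hf₂l : ∃ K : NNReal, LipschitzOnWith K f₂ (Icc 0 1)) (hf₂1 : f₂ 1 = q)
    -- (H1) for i = 2
    (h2s : u2s ∈ Ico (0:ℝ) 1) (hf₂s : f₂ u2s = q)
    (hf₂mono : StrictMonoOn f₂ (Icc 0 u2s)) (hf₂gt : ∀ s ∈ Ioo u2s 1, q < f₂ s) :
    ∀ η : ℝ, 0 < η → ∃ z : ℝ → ℝ,
      Monotone z ∧
      (∀ x : ℝ, z x ∈ Icc (φ u2s) (φ 1)) ∧
      (∀ x : ℝ, HasDerivAt z (f₂ (φinv (z x)) - q) x) ∧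
      (∀ x ≤ η, z x ≤ φ ((1 + u2s) / 2)) ∧
      (∀ x ≥ η, φ ((1 + u2s) / 2) ≤ z x) ∧
      Tendsto z atBot (nhds (φ u2s)) ∧
      Tendsto z atTop (nhds (φ 1)) := by
  intro η _
  obtain ⟨K, hK⟩ := hf₂l
  have hu : u2s ∈ Icc (0 : ℝ) 1 := ⟨h2s.1, h2s.2.le⟩
  have h1 : (1 : ℝ) ∈ Icc (0 : ℝ) 1 := ⟨zero_le_one, le_rfl⟩
  have hmid : (1 + u2s) / 2 ∈ Icc (0 : ℝ) 1 := ⟨by linarith [h2s.1], by linarith [h2s.2]⟩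
  have hφ0 : φ 0 = 0 := by simp [hφ]
  have hφu : 0 ≤ φ u2s := hφ0 ▸ hφmono.monotoneOn ⟨le_rfl, zero_le_one⟩ hu h2s.1
  have hsub : Icc (φ u2s) (φ 1) ⊆ Icc 0 (φ 1) := Icc_subset_Icc_left hφu
  have hm : φ ((1 + u2s) / 2) ∈ Ioo (φ u2s) (φ 1) :=
    ⟨hφmono hu hmid (by linarith [h2s.2]), hφmono hmid h1 (by linarith [h2s.2])⟩
  have hF : ContinuousOn (fun y => f₂ (φinv y) - q) (Icc (φ u2s) (φ 1)) :=
    (hK.continuousOn.comp (hφinvcont.mono hsub) fun y hy => (hφinv y (hsub hy)).1).sub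
      continuousOn_const
  obtain ⟨z, hz, hmem, hder, hzη, hbot, htop⟩ := exists_monotone_heteroclinic hm hF
    (by simp [hφinv' _ hu, hf₂s]) (by simp [hφinv' _ h1, hf₂1])
    (fun y hy => by
      obtain ⟨hv, hvy⟩ := hφinv y (hsub (Ioo_subset_Icc_self hy))
      refine sub_pos.2 (hf₂gt _ ⟨(hφmono.lt_iff_lt hu hv).1 ?_, (hφmono.lt_iff_lt hv h1).1 ?_⟩)
      · rw [hvy]; exact hy.1
      · rw [hvy]; exact hy.2) η
  exact ⟨z, hz, hmem, hder, fun x hx => hzη ▸ hz hx, fun x hx => hzη ▸ hz hx, hbot, htop⟩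
end
end

section
/- (Nonlinear weak-star convergence.) Let Q be a Borel subset of ℝ^k and let (u_n) be a bounded sequence in L∞(Q). Then there exist u ∈ L∞(Q×(0,1)) and a subsequence (u_{n_j}) such that u_{n_j} converges to u in the nonlinear weak-star sense: for every continuous g : ℝ → ℝ and every h ∈ L¹(Q), ∫_Q g(u_{n_j}(x)) h(x) dx → ∫_Q (∫₀¹ g(u(x,α)) dα) h(x) dx as j → ∞. -/
open MeasureTheory Set Filter

noncomputable section

/-- Uniformly bounded functions converging weakly against bounded continuous functions
converge weakly against all integrable functions. -/
theorem tendsto_integral_mul_of_forall_boundedContinuous {X : Type*} [TopologicalSpace X]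
    [NormalSpace X] [MeasurableSpace X] [BorelSpace X] {ν : Measure X} [Measure.WeaklyRegular ν]
    {G : ℕ → X → ℝ} {G₀ : X → ℝ} {C : ℝ}
    (hG : ∀ j, AEStronglyMeasurable (G j) ν) (hG₀ : AEStronglyMeasurable G₀ ν)
    (hGC : ∀ j x, ‖G j x‖ ≤ C) (hG₀C : ∀ x, ‖G₀ x‖ ≤ C)
    (hlim : ∀ φ : BoundedContinuousFunction X ℝ, Integrable φ ν →
      Tendsto (fun j => ∫ x, G j x * φ x ∂ν) atTop (nhds (∫ x, G₀ x * φ x ∂ν)))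
    {h : X → ℝ} (hh : Integrable h ν) :
    Tendsto (fun j => ∫ x, G j x * h x ∂ν) atTop (nhds (∫ x, G₀ x * h x ∂ν)) := by
  have key : ∀ F : X → ℝ, AEStronglyMeasurable F ν → (∀ x, ‖F x‖ ≤ C) →
      ∀ φ : X → ℝ, Integrable φ ν →
      dist (∫ x, F x * h x ∂ν) (∫ x, F x * φ x ∂ν) ≤ |C| * ∫ x, ‖h x - φ x‖ ∂ν := by
    intro F hF hFC φ hφ
    have hFC' : ∀ᵐ x ∂ν, ‖F x‖ ≤ C := ae_of_all _ hFC
    rw [dist_eq_norm, ← integral_sub (hh.bdd_mul hF hFC') (hφ.bdd_mul hF hFC'),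
      ← integral_const_mul]
    refine norm_integral_le_of_norm_le ((hh.sub hφ).norm.const_mul _) (ae_of_all _ fun x => ?_)
    rw [← mul_sub, norm_mul]
    exact mul_le_mul_of_nonneg_right ((hFC x).trans (le_abs_self C)) (norm_nonneg _)
  rw [Metric.tendsto_atTop]
  intro ε hε
  have hC : 0 < |C| + 1 := by positivity
  obtain ⟨φ, hφ, hφi⟩ := hh.exists_boundedContinuous_integral_sub_le
    (ε := ε / (4 * (|C| + 1))) (by positivity)
  have hsmall : |C| * ∫ x, ‖h x - φ x‖ ∂ν ≤ ε / 4 := by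
    calc |C| * ∫ x, ‖h x - φ x‖ ∂ν ≤ (|C| + 1) * (ε / (4 * (|C| + 1))) := by
          gcongr
          linarith
      _ = ε / 4 := by field_simp
  obtain ⟨N, hN⟩ := Metric.tendsto_atTop.1 (hlim φ hφi) (ε / 4) (by positivity)
  refine ⟨N, fun n hn => ?_⟩
  have h1 := key (G n) (hG n) (hGC n) φ hφi
  have h2 := key G₀ hG₀ hG₀C φ hφi
  rw [dist_comm] at h2
  have h3 := dist_triangle4 (∫ x, G n x * h x ∂ν) (∫ x, G n x * φ x ∂ν)
    (∫ x, G₀ x * φ x ∂ν) (∫ x, G₀ x * h x ∂ν)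
  have h4 := hN n hn
  linarith

/-- **Fundamental theorem on Young measures**, with the limit kernel represented by a measurable
function on `X × [0,1]`. -/
theorem exists_subseq_tendsto_integral_comp_mul {X Y : Type*}
    [TopologicalSpace X] [PolishSpace X] [MeasurableSpace X] [BorelSpace X]
    [TopologicalSpace Y] [PolishSpace Y] [CompactSpace Y] [Nonempty Y]
    [MeasurableSpace Y] [BorelSpace Y]
    (ν : Measure X) [IsProbabilityMeasure ν] (v : ℕ → X → Y) (hv : ∀ n, Measurable (v n)) :
    ∃ (f : X → unitInterval → Y) (σ : ℕ → ℕ), Measurable (Function.uncurry f) ∧ StrictMono σ ∧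
      ∀ g : C(Y, ℝ), ∀ h : X → ℝ, Integrable h ν →
        Tendsto (fun j => ∫ x, g (v (σ j) x) * h x ∂ν) atTop
          (nhds (∫ x, (∫ α, g (f x α)) * h x ∂ν)) := by
  have hpair : ∀ n, Measurable fun x => (x, v n x) := fun n => measurable_id.prodMk (hv n)
  let m : ℕ → ProbabilityMeasure (X × Y) := fun n =>
    ⟨ν.map fun x => (x, v n x), Measure.isProbabilityMeasure_map (hpair n).aemeasurable⟩
  have hfst : ∀ n, (m n : Measure (X × Y)).fst = ν := fun n => by
    change (ν.map fun x => (x, v n x)).fst = ν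
    rw [Measure.fst, Measure.map_map measurable_fst (hpair n)]
    exact Measure.map_id
  have htight : IsTightMeasureSet
      {((μ : ProbabilityMeasure (X × Y)) : Measure (X × Y)) | μ ∈ range m} := by
    refine IsTightMeasureSet.prodMk ((isTightMeasureSet_singleton (μ := ν)).subset ?_)
      IsTightMeasureSet.of_compactSpace
    rintro _ ⟨_, ⟨_, ⟨n, rfl⟩, rfl⟩, rfl⟩
    exact hfst n
  obtain ⟨ρ, -, σ, hσ, hρ⟩ := (isCompact_closure_of_isTightMeasureSet htight).isSeqCompact
    (fun n => subset_closure (mem_range_self n))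
  have hρfst : (ρ : Measure (X × Y)).fst = ν := by
    have h1 := ProbabilityMeasure.tendsto_map_of_tendsto_of_continuous _ _ hρ
      (continuous_fst (X := X) (Y := Y))
    let νP : ProbabilityMeasure X := ⟨ν, inferInstance⟩
    have h2 : ∀ n, (m n).map (continuous_fst (X := X) (Y := Y)).measurable.aemeasurable
        = νP := fun n => Subtype.ext (hfst n)
    simp only [Function.comp_apply, h2] at h1
    have h3 := tendsto_nhds_unique h1 tendsto_const_nhds
    exact congrArg Subtype.val h3
  obtain ⟨f, hf, hfκ⟩ :=
    (ρ : Measure (X × Y)).condKernel.exists_measurable_map_eq_unitInterval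
  refine ⟨f, σ, hf, hσ, fun g h hh => ?_⟩
  have hgf : ∀ x, ∫ α, g (f x α) = ∫ y, g y ∂(ρ : Measure (X × Y)).condKernel x := fun x => by
    rw [← hfκ x, integral_map (hf.of_uncurry_left).aemeasurable
      g.continuous.measurable.aestronglyMeasurable]
  refine tendsto_integral_mul_of_forall_boundedContinuous (C := ‖g‖)
    (fun j => (g.continuous.measurable.comp (hv (σ j))).aestronglyMeasurable)
    ?_ (fun j x => g.norm_coe_le_norm _) (fun x => ?_) (fun φ hφ => ?_) hh
  · exact ((g.continuous.measurable.comp hf).stronglyMeasurable.integral_prod_right'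
      (ν := volume)).aestronglyMeasurable
  · simpa using norm_integral_le_of_norm_le_const (μ := (volume : Measure unitInterval))
      (ae_of_all _ fun α => g.norm_coe_le_norm (f x α))
  · let Φ : BoundedContinuousFunction (X × Y) ℝ :=
      (BoundedContinuousFunction.mkOfCompact g).compContinuous ⟨Prod.snd, continuous_snd⟩ *
        φ.compContinuous ⟨Prod.fst, continuous_fst⟩
    have hΦ := (ProbabilityMeasure.tendsto_iff_forall_integral_tendsto.1 hρ) Φ
    have hl : ∀ j, ∫ p, Φ p ∂(m (σ j) : Measure (X × Y)) = ∫ x, g (v (σ j) x) * φ x ∂ν :=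
      fun j => integral_map (hpair _).aemeasurable
        Φ.continuous.measurable.aestronglyMeasurable
    have hr : ∫ p, Φ p ∂(ρ : Measure (X × Y)) = ∫ x, (∫ α, g (f x α)) * φ x ∂ν := by
      rw [← Measure.integral_condKernel (Φ.integrable _), hρfst]
      refine integral_congr_ae (ae_of_all _ fun x => ?_)
      simp only [hgf]
      exact integral_mul_const (φ x) fun y => g y
    simpa only [Function.comp_apply, hl, hr] using hΦ

/-- Nonlinear weak-star convergence (Theorem 3.1): any bounded sequence in `L∞(Q)`
admits a subsequence converging in the nonlinear weak-star sense to some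
`u ∈ L∞(Q × (0,1))`: for every continuous `g : ℝ → ℝ`,
`g(u_n) ⇀ ∫₀¹ g(u(·,α)) dα` weakly-star in `L∞(Q)`. -/
theorem stmt12 (k : ℕ) (Q : Set (Fin k → ℝ)) (hQ : MeasurableSet Q)
    (un : ℕ → (Fin k → ℝ) → ℝ)
    (hmeas : ∀ n, AEMeasurable (un n) (volume.restrict Q))
    (hbdd : ∃ M : ℝ, ∀ n, ∀ᵐ x ∂ volume.restrict Q, |un n x| ≤ M) :
    ∃ (u : (Fin k → ℝ) → ℝ → ℝ) (σ : ℕ → ℕ), StrictMono σ ∧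
      AEMeasurable (fun p : (Fin k → ℝ) × ℝ => u p.1 p.2)
        ((volume.restrict Q).prod (volume.restrict (Ioo (0:ℝ) 1))) ∧
      (∃ M : ℝ, ∀ᵐ p ∂ (volume.restrict Q).prod (volume.restrict (Ioo (0:ℝ) 1)),
        |u p.1 p.2| ≤ M) ∧
      ∀ g : ℝ → ℝ, Continuous g →
        ∀ h : (Fin k → ℝ) → ℝ, Integrable h (volume.restrict Q) →
          Tendsto (fun j => ∫ x in Q, g (un (σ j) x) * h x) atTop
            (nhds (∫ x in Q, (∫ α in Ioo (0:ℝ) 1, g (u x α)) * h x)) := by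
  obtain ⟨M, hM⟩ := hbdd
  rcases eq_zero_or_neZero (volume.restrict Q) with h0 | hne
  · exact ⟨fun _ _ => 0, id, strictMono_id, aemeasurable_const, ⟨0, by simp⟩, by simp [h0]⟩
  set μ := volume.restrict Q
  have hμν := absolutelyContinuous_toFinite μ
  have hM' : -|M| ≤ |M| := neg_le_self (abs_nonneg M)
  have : Nonempty (Icc (-|M|) |M|) := ⟨⟨|M|, hM', le_rfl⟩⟩
  let v : ℕ → (Fin k → ℝ) → Icc (-|M|) |M| := fun n x => projIcc _ _ hM' ((hmeas n).mk _ x)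
  have hv : ∀ n, Measurable (v n) := fun n =>
    continuous_projIcc.measurable.comp (hmeas n).measurable_mk
  have hvu : ∀ n, ∀ᵐ x ∂μ, (v n x : ℝ) = un n x := fun n => by
    filter_upwards [(hmeas n).ae_eq_mk, hM n] with x hx hxM
    have : un n x ∈ Icc (-|M|) |M| := abs_le.1 (hxM.trans (le_abs_self M))
    simp only [v, ← hx, projIcc_of_mem hM' this]
  obtain ⟨f, σ, hf, hσ, hlim⟩ := exists_subseq_tendsto_integral_comp_mul μ.toFinite v hv
  refine ⟨fun x α => f x (projIcc 0 1 zero_le_one α), σ, hσ, ?_,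
    ⟨|M|, ae_of_all _ fun p => abs_le.2 (f p.1 _).2⟩, fun g hg h hh => ?_⟩
  · have hproj : Measurable (projIcc (0 : ℝ) 1 zero_le_one) := continuous_projIcc.measurable
    exact (measurable_subtype_coe.comp
      (hf.comp (measurable_fst.prodMk (hproj.comp measurable_snd)))).aemeasurable
  have hIoo : ∀ x, ∫ α in Ioo (0 : ℝ) 1, g (f x (projIcc 0 1 zero_le_one α))
      = ∫ α, g (f x α) := fun x => by
    rw [← integral_Icc_eq_integral_Ioo, ← integral_subtype measurableSet_Icc]
    simp only [projIcc_val]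
  have hchange : ∀ F : (Fin k → ℝ) → ℝ,
      ∫ x, F x * ((μ.rnDeriv μ.toFinite x).toReal * h x) ∂μ.toFinite = ∫ x, F x * h x ∂μ :=
    fun F => by
      rw [← integral_rnDeriv_smul hμν]
      exact integral_congr_ae (ae_of_all _ fun x => by simp only [smul_eq_mul]; ring)
  have hconv := hlim ⟨fun y => g y, hg.comp continuous_subtype_val⟩ _
    ((integrable_rnDeriv_smul_iff hμν).2 hh)
  simp only [ContinuousMap.coe_mk, smul_eq_mul, hchange] at hconv
  simp only [hIoo]
  refine hconv.congr fun j => integral_congr_ae ?_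
  filter_upwards [hvu (σ j)] with x hx
  rw [hx]
end
end

section
/- Let u₀ ∈ L¹(ℝ) with 0 ≤ u₀ ≤ u_i^⋆ a.e. in Ω_i (i = 1,2). Then there exists a family (u₀^ε)_{ε>0} ⊂ L¹(ℝ) with 0 ≤ u₀^ε ≤ 1 a.e. such that: (i) the weak derivative ∂_x φ_i(u₀^ε) belongs to L∞(Ω_i) for i = 1,2; (ii) ess lim_{x↗0} u₀^ε(x) = 1; (iii) u₀^ε → u₀ in L¹_loc(ℝ) as ε → 0. -/
open MeasureTheory Set Filter

noncomputable section

/-- `w` is the weak derivative of `v` on the open set `Ω ⊆ ℝ`. -/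
def IsWeakDerivOn (Ω : Set ℝ) (v w : ℝ → ℝ) : Prop :=
  ∀ θ : ℝ → ℝ, ContDiff ℝ (⊤ : ℕ∞) θ → HasCompactSupport θ → (∀ x ∉ Ω, θ x = 0) →
    ∫ x in Ω, v x * deriv θ x = - ∫ x in Ω, w x * θ x

/-- A Lipschitz function on `ℝ` has its pointwise derivative as weak derivative on every set
with negligible frontier. -/
theorem LipschitzWith.isWeakDerivOn {K : NNReal} {v : ℝ → ℝ} (hv : LipschitzWith K v)
    {Ω : Set ℝ} (hΩ : volume (frontier Ω) = 0) : IsWeakDerivOn Ω v (deriv v) := by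
  intro θ hθ hθc hθ0
  obtain ⟨D, hD⟩ := hθ.lipschitzWith_of_hasCompactSupport hθc (by simp)
  have hline : ∀ (f : ℝ → ℝ) (x : ℝ), lineDeriv ℝ f x 1 = deriv f x := by
    intro f x
    simp only [lineDeriv, smul_eq_mul, mul_one]
    rw [deriv_comp_const_add, add_zero]
  have hparts := hv.integral_lineDeriv_mul_eq (μ := volume) hD hθc 1
  simp only [lineDeriv_neg, hline] at hparts
  have hderiv : ∀ᵐ x : ℝ, x ∉ Ω → deriv θ x = 0 := by
    filter_upwards [measure_eq_zero_iff_ae_notMem.mp hΩ] with x hx hxΩ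
    have hmem : x ∈ interior Ωᶜ := by
      rw [interior_compl]
      intro hcl
      exact hx ⟨hcl, fun hint => hxΩ (interior_subset hint)⟩
    have : θ =ᶠ[nhds x] fun _ => 0 := by
      filter_upwards [mem_interior_iff_mem_nhds.mp hmem] with y hy using hθ0 y hy
    rw [this.deriv_eq, deriv_const]
  rw [setIntegral_eq_integral_of_ae_compl_eq_zero
      (by filter_upwards [hderiv] with x hx hxΩ using by rw [hx hxΩ, mul_zero]),
    setIntegral_eq_integral_of_forall_compl_eq_zero
      (fun x hx => by rw [hθ0 x hx, mul_zero]), hparts, ← integral_neg]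
  congr 1
  ext x
  ring

/-- The primitive of a function continuous on `[0, 1]` is Lipschitz on `[0, 1]`. -/
theorem ContinuousOn.exists_lipschitzOnWith_primitive {g φ : ℝ → ℝ} {c : ℝ}
    (hg : ContinuousOn g (Icc 0 1)) (hφ : ∀ s, φ s = c * ∫ r in (0:ℝ)..s, g r) :
    ∃ K : NNReal, LipschitzOnWith K φ (Icc 0 1) := by
  obtain ⟨M, hM⟩ := isCompact_Icc.exists_bound_of_continuousOn hg
  have hM0 : 0 ≤ M := (norm_nonneg _).trans (hM 0 (by simp))
  have hint : ∀ a ∈ Icc (0:ℝ) 1, IntervalIntegrable g volume 0 a := fun a ha =>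
    (hg.mono (by rw [uIcc_of_le ha.1]; exact Icc_subset_Icc_right ha.2)).intervalIntegrable
  refine ⟨Real.toNNReal (|c| * M), LipschitzOnWith.of_dist_le_mul fun a ha b hb => ?_⟩
  rw [Real.coe_toNNReal _ (by positivity), Real.dist_eq, Real.dist_eq, hφ, hφ, ← mul_sub,
    intervalIntegral.integral_interval_sub_left (hint a ha) (hint b hb), abs_mul, mul_assoc]
  gcongr
  refine intervalIntegral.norm_integral_le_of_norm_le_const fun x hx => hM x ?_
  exact uIcc_subset_Icc hb ha (uIoc_subset_uIcc hx)

/-- An integrable function with values in `[0, 1]` can be approximated in `L¹` by integrable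
Lipschitz functions with values in `[0, 1]` which equal `1` at the origin. -/
theorem MeasureTheory.Integrable.exists_lipschitz_eq_one_at_zero {u : ℝ → ℝ}
    (hu : Integrable u) (hu01 : ∀ᵐ x : ℝ, u x ∈ Icc (0:ℝ) 1) {ε : ℝ} (hε : 0 < ε) :
    ∃ f : ℝ → ℝ, Integrable f ∧ (∃ K : NNReal, LipschitzWith K f) ∧
      (∀ x, f x ∈ Icc (0:ℝ) 1) ∧ f 0 = 1 ∧ ∫ x, |f x - u x| ≤ 3 * ε := by
  obtain ⟨g, hgc, hgs, hgu⟩ :=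
    (memLp_one_iff_integrable.mpr hu).exist_eLpNorm_sub_le ENNReal.one_ne_top le_rfl hε
  obtain ⟨D, hD⟩ := hgs.lipschitzWith_of_hasCompactSupport hgc (by simp)
  have hgi : Integrable g := hgs.continuous.integrable_of_hasCompactSupport hgc
  have hgu' : ∫ x, |g x - u x| ≤ ε := by
    have h := integral_norm_eq_lintegral_enorm (hu.sub hgi).aestronglyMeasurable
    rw [← eLpNorm_one_eq_lintegral_enorm] at h
    calc ∫ x, |g x - u x| = ∫ x, ‖(u - g) x‖ := by
          congr 1
          ext x
          rw [abs_sub_comm, Pi.sub_apply, Real.norm_eq_abs]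
      _ ≤ ε := by
          rw [h]
          exact ENNReal.toReal_le_of_le_ofReal hε.le hgu
  set t : ℝ → ℝ := fun x => max 0 (1 - |x| / ε) with ht
  have htL : LipschitzWith (Real.toNNReal (1 / ε)) t := by
    refine LipschitzWith.const_max (LipschitzWith.of_le_add_mul _ fun x y => ?_) 0
    rw [Real.coe_toNNReal _ (by positivity), Real.dist_eq, div_mul_eq_mul_div, one_mul]
    have h : |y| / ε ≤ |x| / ε + |x - y| / ε := by
      rw [← add_div]
      gcongr
      have := abs_sub_abs_le_abs_sub y x
      rw [abs_sub_comm y x] at this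
      linarith
    linarith
  have hti0 : Integrable ((Icc (-ε) ε).indicator fun _ => (1:ℝ)) :=
    (integrable_indicator_iff measurableSet_Icc).mpr (integrableOn_const (by simp))
  have ht0 : ∀ x, 0 ≤ t x := fun x => le_max_left _ _
  have ht1 : ∀ x, t x ≤ 1 := fun x =>
    max_le zero_le_one (sub_le_self _ (by positivity))
  have htind : ∀ x, t x ≤ (Icc (-ε) ε).indicator (fun _ => (1:ℝ)) x := by
    intro x
    by_cases hx : x ∈ Icc (-ε) ε
    · rw [indicator_of_mem hx]
      exact ht1 x
    · rw [indicator_of_notMem hx]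
      have : ε < |x| := by
        by_contra! h
        exact hx (abs_le.mp h)
      refine max_le le_rfl ?_
      rw [sub_nonpos, one_le_div hε]
      exact this.le
  have hti : Integrable t := hti0.mono' htL.continuous.aestronglyMeasurable
    (ae_of_all _ fun x => by rw [Real.norm_of_nonneg (ht0 x)]; exact htind x)
  have htint : ∫ x, t x ≤ 2 * ε := by
    refine (integral_mono hti hti0 htind).trans ?_
    rw [integral_indicator measurableSet_Icc]
    simp only [integral_const, MeasurableSet.univ, measureReal_restrict_apply, univ_inter,
      Real.volume_real_Icc, smul_eq_mul, mul_one]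
    exact max_le (by linarith) (by linarith)
  set f : ℝ → ℝ := fun x => max (max 0 (min 1 (g x))) (t x) with hf
  have hfL : LipschitzWith (max D (Real.toNNReal (1 / ε))) f :=
    ((hD.const_min 1).const_max 0).max htL
  have hfi : Integrable f := by
    refine (hgi.abs.add hti).mono' hfL.continuous.aestronglyMeasurable (ae_of_all _ fun x => ?_)
    rw [Real.norm_of_nonneg ((ht0 x).trans (le_max_right _ _))]
    refine max_le (max_le ?_ ((min_le_right _ _).trans ?_)) ?_
    · exact add_nonneg (abs_nonneg _) (ht0 x)
    · exact (le_abs_self _).trans (le_add_of_nonneg_right (ht0 x))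
    · exact le_add_of_nonneg_left (abs_nonneg _)
  refine ⟨f, hfi, ⟨_, hfL⟩, fun x => ⟨(ht0 x).trans (le_max_right _ _), ?_⟩, ?_, ?_⟩
  · exact max_le (max_le zero_le_one (min_le_left _ _)) (ht1 x)
  · simp [hf, ht]
  · calc ∫ x, |f x - u x| ≤ ∫ x, (|g x - u x| + t x) := by
          refine integral_mono_ae (hfi.sub hu).abs ((hgi.sub hu).abs.add hti) ?_
          filter_upwards [hu01] with x hx
          have h0 := ht0 x
          have h1 := hx.1
          have h2 := hx.2
          simp only [hf]
          grind
      _ = (∫ x, |g x - u x|) + ∫ x, t x := integral_add (hgi.sub hu).abs hti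
      _ ≤ 3 * ε := by linarith

/-- If `φ` is Lipschitz on `[0, 1]` and `f` is a Lipschitz function with values in `[0, 1]`,
then `φ ∘ f` has a bounded weak derivative. -/
theorem LipschitzOnWith.exists_bounded_isWeakDerivOn_comp {φ f : ℝ → ℝ} {K L : NNReal}
    (hφ : LipschitzOnWith K φ (Icc 0 1)) (hf : LipschitzWith L f)
    (hf01 : ∀ x, f x ∈ Icc (0:ℝ) 1) {Ω : Set ℝ} (hΩ : volume (frontier Ω) = 0) :
    ∃ d : ℝ → ℝ, IsWeakDerivOn Ω (fun x => φ (f x)) d ∧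
      ∃ M : ℝ, ∀ᵐ x ∂ volume.restrict Ω, |d x| ≤ M := by
  have h : LipschitzWith (K * L) fun x => φ (f x) :=
    lipschitzOnWith_univ.mp (hφ.comp hf.lipschitzOnWith fun x _ => hf01 x)
  exact ⟨_, h.isWeakDerivOn hΩ, _, ae_of_all _ fun x => norm_deriv_le_of_lipschitz h⟩

/-- Lemma 4.1: approximation of a small initial datum (`0 ≤ u₀ ≤ u_i⋆` in `Ω_i`)
by a family `(u₀^ε)` of prepared data: `u₀^ε ∈ L¹`, `∂ₓφ_i(u₀^ε) ∈ L∞(Ω_i)`,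
`ess lim_{x↗0} u₀^ε(x) = 1`, and `u₀^ε → u₀` in `L¹_loc(ℝ)` as `ε → 0`. -/
theorem stmt15 (u1s u2s Cc : ℝ)
    (h1s : u1s ∈ Ico (0:ℝ) 1) (h2s : u2s ∈ Ico (0:ℝ) 1) (hC : 0 < Cc)
    (g₁ g₂ φ₁ φ₂ : ℝ → ℝ)
    (hg₁l : ∃ K : NNReal, LipschitzOnWith K g₁ (Icc 0 1))
    (hg₂l : ∃ K : NNReal, LipschitzOnWith K g₂ (Icc 0 1))
    (hg₁p : ∀ s ∈ Ioo (0:ℝ) 1, 0 < g₁ s) (hg₂p : ∀ s ∈ Ioo (0:ℝ) 1, 0 < g₂ s)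
    (hg₁0 : g₁ 0 = 0) (hg₁1 : g₁ 1 = 0) (hg₂0 : g₂ 0 = 0) (hg₂1 : g₂ 1 = 0)
    (hφ₁ : ∀ s, φ₁ s = Cc * ∫ r in (0:ℝ)..s, g₁ r)
    (hφ₂ : ∀ s, φ₂ s = Cc * ∫ r in (0:ℝ)..s, g₂ r)
    (hφ₁mono : StrictMonoOn φ₁ (Icc 0 1)) (hφ₂mono : StrictMonoOn φ₂ (Icc 0 1))
    (u₀ : ℝ → ℝ) (hu₀int : Integrable u₀)
    (hu₀ : ∀ᵐ x : ℝ, (x < 0 → u₀ x ∈ Icc 0 u1s) ∧ (0 < x → u₀ x ∈ Icc 0 u2s)) :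
    ∃ U : ℝ → ℝ → ℝ,
      (∀ ε : ℝ, 0 < ε →
        Integrable (U ε) ∧
        (∀ᵐ x : ℝ, U ε x ∈ Icc (0:ℝ) 1) ∧
        -- (i) `∂ₓ φ_i(u₀^ε) ∈ L∞(Ω_i)`
        (∃ d₁ d₂ : ℝ → ℝ,
          IsWeakDerivOn (Iio 0) (fun x => φ₁ (U ε x)) d₁ ∧
          (∃ M : ℝ, ∀ᵐ x ∂ volume.restrict (Iio (0:ℝ)), |d₁ x| ≤ M) ∧
          IsWeakDerivOn (Ioi 0) (fun x => φ₂ (U ε x)) d₂ ∧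
          (∃ M : ℝ, ∀ᵐ x ∂ volume.restrict (Ioi (0:ℝ)), |d₂ x| ≤ M)) ∧
        -- (ii) `ess lim_{x↗0} u₀^ε(x) = 1`
        Tendsto (U ε) (nhdsWithin 0 (Iio 0) ⊓ ae volume) (nhds 1)) ∧
      -- (iii) `u₀^ε → u₀` in `L¹_loc(ℝ)` as `ε → 0`
      (∀ K : Set ℝ, IsCompact K →
        Tendsto (fun ε => ∫ x in K, |U ε x - u₀ x|) (nhdsWithin 0 (Ioi 0)) (nhds 0)) := by
  obtain ⟨K₁, hK₁⟩ := hg₁l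
  obtain ⟨K₂, hK₂⟩ := hg₂l
  obtain ⟨L₁, hL₁⟩ := hK₁.continuousOn.exists_lipschitzOnWith_primitive hφ₁
  obtain ⟨L₂, hL₂⟩ := hK₂.continuousOn.exists_lipschitzOnWith_primitive hφ₂
  have hu01 : ∀ᵐ x : ℝ, u₀ x ∈ Icc (0:ℝ) 1 := by
    filter_upwards [hu₀, Measure.ae_ne volume 0] with x hx hx0
    rcases lt_or_gt_of_ne hx0 with h | h
    · exact ⟨(hx.1 h).1, (hx.1 h).2.trans h1s.2.le⟩
    · exact ⟨(hx.2 h).1, (hx.2 h).2.trans h2s.2.le⟩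
  have hex : ∀ ε : ℝ, ∃ f : ℝ → ℝ, 0 < ε → Integrable f ∧ (∃ K : NNReal, LipschitzWith K f) ∧
      (∀ x, f x ∈ Icc (0:ℝ) 1) ∧ f 0 = 1 ∧ ∫ x, |f x - u₀ x| ≤ 3 * ε := by
    intro ε
    by_cases hε : 0 < ε
    · obtain ⟨f, hf⟩ := hu₀int.exists_lipschitz_eq_one_at_zero hu01 hε
      exact ⟨f, fun _ => hf⟩
    · exact ⟨0, fun h => absurd h hε⟩
  choose U hU using hex
  refine ⟨U, fun ε hε => ?_, fun K _ => ?_⟩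
  · obtain ⟨hint, ⟨L, hL⟩, h01, h0, -⟩ := hU ε hε
    refine ⟨hint, ae_of_all _ h01, ?_, ?_⟩
    · obtain ⟨d₁, hd₁, hb₁⟩ := hL₁.exists_bounded_isWeakDerivOn_comp hL h01
        (Ω := Iio 0) (by simp)
      obtain ⟨d₂, hd₂, hb₂⟩ := hL₂.exists_bounded_isWeakDerivOn_comp hL h01
        (Ω := Ioi 0) (by simp)
      exact ⟨d₁, d₂, hd₁, hb₁, hd₂, hb₂⟩
    · have h : Tendsto (U ε) (nhds 0) (nhds 1) := h0 ▸ hL.continuous.tendsto 0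
      exact h.mono_left (inf_le_left.trans nhdsWithin_le_nhds)
  · have hlim : Tendsto (fun ε : ℝ => 3 * ε) (nhdsWithin 0 (Ioi 0)) (nhds 0) := by
      have : Tendsto (fun ε : ℝ => 3 * ε) (nhds 0) (nhds (3 * 0)) := tendsto_id.const_mul 3
      rw [mul_zero] at this
      exact this.mono_left nhdsWithin_le_nhds
    refine squeeze_zero' (Eventually.of_forall fun ε => integral_nonneg fun x => abs_nonneg _)
      ?_ hlim
    filter_upwards [self_mem_nhdsWithin] with ε hε
    obtain ⟨hint, -, -, -, hle⟩ := hU ε hε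
    exact (setIntegral_le_integral (hint.sub hu₀int).abs
      (ae_of_all _ fun x => abs_nonneg _)).trans hle
end
end

section
/- (Kato inequality implies L¹ contraction with finite speed of propagation.) Let M > 0, let w ∈ L∞(ℝ×(0,∞)) with w ≥ 0 a.e., let w₀ ∈ L∞(ℝ) with w₀ ≥ 0 a.e., and let Φ ∈ L∞(ℝ×(0,∞)) satisfy |Φ| ≤ M w a.e. Assume that for every nonnegative Lipschitz continuous compactly supported test function ψ on ℝ×[0,∞): ∫₀^∞∫_ℝ w ∂_tψ dx dt + ∫_ℝ w₀ ψ(x,0) dx + ∫₀^∞∫_ℝ Φ ∂_xψ dx dt ≥ 0. Then for almost every t > 0 and every R > 0: ∫_{-R}^{R} w(x,t) dx ≤ ∫_{-R - M t}^{R + M t} w₀(x) dx. -/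
open MeasureTheory Set Filter

noncomputable section

open scoped Topology

/-- Lebesgue measure on the half plane `ℝ × (0, ∞)`. -/
abbrev halfPlane : Measure (ℝ × ℝ) :=
  (volume : Measure ℝ).prod (volume.restrict (Ioi (0 : ℝ)))

lemma halfPlane_eq_restrict :
    halfPlane = (volume : Measure (ℝ × ℝ)).restrict (univ ×ˢ Ioi 0) := by
  rw [Measure.volume_eq_prod, ← Measure.prod_restrict, Measure.restrict_univ]

lemma ae_halfPlane {P : ℝ × ℝ → Prop} (h : ∀ᵐ p : ℝ × ℝ, 0 < p.2 → P p) :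
    ∀ᵐ p ∂halfPlane, P p := by
  rw [halfPlane_eq_restrict, ae_restrict_iff' (MeasurableSet.univ.prod measurableSet_Ioi)]
  filter_upwards [h] with p hp hmem
  exact hp hmem.2

lemma ae_halfPlane_pos : ∀ᵐ p ∂halfPlane, 0 < p.2 :=
  ae_halfPlane (Eventually.of_forall fun _ hp => hp)

lemma fderiv_apply_nonpos {E : Type*} [NormedAddCommGroup E] [NormedSpace ℝ E] {f : E → ℝ}
    {p v : E} (hf : DifferentiableAt ℝ f p) (h : ∀ s : ℝ, 0 ≤ s → f (p + s • v) ≤ f p) :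
    fderiv ℝ f p v ≤ 0 := by
  have hd : HasDerivAt (fun s : ℝ => f (p + s • v)) (fderiv ℝ f p v) 0 := by
    have h1 : HasDerivAt (fun s : ℝ => p + s • v) v 0 := by
      simpa using ((hasDerivAt_id (0 : ℝ)).smul_const v).const_add p
    have h2 : HasFDerivAt f (fderiv ℝ f p) (p + (0 : ℝ) • v) := by
      simpa using hf.hasFDerivAt
    exact h2.comp_hasDerivAt 0 h1
  refine le_of_tendsto hd.tendsto_slope_zero_right ?_
  filter_upwards [self_mem_nhdsWithin] with s hs
  have hs' : (0 : ℝ) < s := hs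
  have := h s hs'.le
  simp only [zero_add, zero_smul, add_zero, smul_eq_mul]
  exact mul_nonpos_of_nonneg_of_nonpos (inv_nonneg.2 hs'.le) (by linarith)

/-- A trapezoidal cutoff of the backward cone with lateral speed `M`, whose time slice at `S` has
radius `r`; the transition layers have width `h` in space and in time. -/
def coneCutoff (M r S h : ℝ) (p : ℝ × ℝ) : ℝ :=
  max 0 (min (min 1 (p.2 + 1))
    (min ((r + M * (S - p.2) + h - |p.1|) / h) ((S - p.2) / h)))

section coneCutoff

variable {M r S h : ℝ}

lemma coneCutoff_nonneg (p : ℝ × ℝ) : 0 ≤ coneCutoff M r S h p := le_max_left _ _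

lemma coneCutoff_le_one (p : ℝ × ℝ) : coneCutoff M r S h p ≤ 1 :=
  max_le zero_le_one ((min_le_left _ _).trans (min_le_left _ _))

lemma coneCutoff_ne_zero (hh : 0 < h) {p : ℝ × ℝ} (hp : coneCutoff M r S h p ≠ 0) :
    |p.1| ≤ r + M * (S - p.2) + h ∧ -1 ≤ p.2 ∧ p.2 ≤ S := by
  have hpos : 0 < coneCutoff M r S h p := lt_of_le_of_ne (coneCutoff_nonneg p) hp.symm
  simp only [coneCutoff, lt_max_iff, lt_irrefl, false_or, lt_min_iff, div_pos_iff_of_pos_right hh]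
    at hpos
  obtain ⟨⟨-, h1⟩, h2, h3⟩ := hpos
  exact ⟨by linarith, by linarith, by linarith⟩

lemma support_coneCutoff_subset (hM : 0 < M) (hh : 0 < h) :
    Function.support (coneCutoff M r S h) ⊆
      Icc (-(r + M * (S + 1) + h)) (r + M * (S + 1) + h) ×ˢ Icc (-1) S := by
  intro p hp
  obtain ⟨h1, h2, h3⟩ := coneCutoff_ne_zero hh hp
  have : M * (S - p.2) ≤ M * (S + 1) := by gcongr; linarith
  exact ⟨abs_le.1 (by linarith), h2, h3⟩

lemma tsupport_coneCutoff_subset (hM : 0 < M) (hh : 0 < h) :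
    tsupport (coneCutoff M r S h) ⊆
      Icc (-(r + M * (S + 1) + h)) (r + M * (S + 1) + h) ×ˢ Icc (-1) S :=
  closure_minimal (support_coneCutoff_subset hM hh) (isClosed_Icc.prod isClosed_Icc)

lemma hasCompactSupport_coneCutoff (hM : 0 < M) (hh : 0 < h) :
    HasCompactSupport (coneCutoff M r S h) :=
  HasCompactSupport.of_support_subset_isCompact (isCompact_Icc.prod isCompact_Icc)
    (support_coneCutoff_subset hM hh)

lemma exists_lipschitzWith_coneCutoff (hM : 0 < M) (hh : 0 < h) :
    ∃ L, LipschitzWith L (coneCutoff M r S h) := by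
  have hfst (p q : ℝ × ℝ) : |p.1 - q.1| ≤ dist p q := le_max_left _ _
  have hsnd (p q : ℝ × ℝ) : |p.2 - q.2| ≤ dist p q := le_max_right _ _
  have h1 : LipschitzWith 1 fun p : ℝ × ℝ => p.2 + 1 :=
    LipschitzWith.of_dist_le_mul fun p q => by
      simpa [Real.dist_eq] using hsnd p q
  have h2 : LipschitzWith (NNReal.mk ((M + 1) / h) (by positivity))
      fun p : ℝ × ℝ => (r + M * (S - p.2) + h - |p.1|) / h :=
    LipschitzWith.of_dist_le_mul fun p q => by
      rw [Real.dist_eq, ← sub_div, abs_div, abs_of_pos hh, NNReal.coe_mk, div_mul_eq_mul_div]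
      gcongr
      have e : r + M * (S - p.2) + h - |p.1| - (r + M * (S - q.2) + h - |q.1|)
        = M * (q.2 - p.2) + (|q.1| - |p.1|) := by ring
      have e1 : |M * (q.2 - p.2)| ≤ M * dist p q := by
        rw [abs_mul, abs_of_pos hM, abs_sub_comm]
        gcongr
        exact hsnd p q
      have e2 : |(|q.1| - |p.1|)| ≤ dist p q := by
        refine (abs_abs_sub_abs_le _ _).trans ?_
        rw [abs_sub_comm]
        exact hfst p q
      rw [e]
      refine (abs_add_le _ _).trans ?_
      linarith
  have h3 : LipschitzWith (NNReal.mk (1 / h) (by positivity)) fun p : ℝ × ℝ => (S - p.2) / h :=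
    LipschitzWith.of_dist_le_mul fun p q => by
      rw [Real.dist_eq, ← sub_div, abs_div, abs_of_pos hh, NNReal.coe_mk, div_mul_eq_mul_div,
        one_mul]
      gcongr
      rw [sub_sub_sub_cancel_left, abs_sub_comm]
      exact hsnd p q
  exact ⟨_, ((h1.const_min 1).min (h2.min h3)).const_max 0⟩

/-- The cutoff does not increase along directions inside the forward cone. -/
lemma coneCutoff_add_smul_le (hh : 0 < h) {p : ℝ × ℝ} (hp : 0 < p.2) {m : ℝ}
    (hm : |m| ≤ M) {s : ℝ} (hs : 0 ≤ s) :
    coneCutoff M r S h (p + s • (m, (1 : ℝ))) ≤ coneCutoff M r S h p := by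
  simp only [coneCutoff, Prod.fst_add, Prod.snd_add, Prod.smul_mk, smul_eq_mul, mul_one]
  have h1 : |p.1| ≤ |p.1 + s * m| + s * M := by
    have := abs_sub (p.1 + s * m) (s * m)
    rw [add_sub_cancel_right, abs_mul, abs_of_nonneg hs] at this
    have := mul_le_mul_of_nonneg_left hm hs
    linarith
  refine max_le_max le_rfl (min_le_min ?_ (min_le_min ?_ ?_))
  · rw [min_eq_left (by linarith : (1 : ℝ) ≤ p.2 + 1)]
    exact min_le_left _ _
  · gcongr ?_ / h
    linarith
  · gcongr
    linarith

lemma coneCutoff_eventuallyEq (hM : 0 < M) (hh : 0 < h) (hS : h < S) {p : ℝ × ℝ}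
    (hp : p ∈ Ioo (-r) r ×ˢ Ioo (S - h) S) :
    coneCutoff M r S h =ᶠ[𝓝 p] fun q => (S - q.2) / h := by
  filter_upwards [(isOpen_Ioo.prod isOpen_Ioo).mem_nhds hp] with q hq
  obtain ⟨hx, ht1, ht2⟩ := hq
  have hx' : |q.1| < r := abs_lt.2 hx
  have h0 : 0 < (S - q.2) / h := div_pos (by linarith) hh
  have h1 : (S - q.2) / h ≤ 1 := by rw [div_le_one hh]; linarith
  have h2 : (S - q.2) / h ≤ (r + M * (S - q.2) + h - |q.1|) / h := by
    have := mul_pos hM (sub_pos.2 ht2)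
    exact div_le_div_of_nonneg_right (by linarith) hh.le
  rw [coneCutoff, min_eq_right h2, min_eq_left (by linarith : (1 : ℝ) ≤ q.2 + 1),
    min_eq_right h1, max_eq_right h0.le]

lemma coneCutoff_flux_le (hM : 0 < M) (hh : 0 < h) (hS : h < S) {p : ℝ × ℝ} (hp : 0 < p.2)
    (hd : DifferentiableAt ℝ (coneCutoff M r S h) p) {v φ : ℝ} (hφ : |φ| ≤ M * v) :
    v * fderiv ℝ (coneCutoff M r S h) p (0, 1) + φ * fderiv ℝ (coneCutoff M r S h) p (1, 0) ≤
      (Ioo (-r) r ×ˢ Ioo (S - h) S).indicator (fun _ => -(v / h)) p := by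
  by_cases hQ : p ∈ Ioo (-r) r ×ˢ Ioo (S - h) S
  · have hf : HasFDerivAt (fun q : ℝ × ℝ => (S - q.2) / h)
        (h⁻¹ • -(ContinuousLinearMap.snd ℝ ℝ ℝ)) p := by
      simp only [div_eq_inv_mul]
      exact (hasFDerivAt_snd.const_sub S).const_smul h⁻¹
    rw [indicator_of_mem hQ, (coneCutoff_eventuallyEq hM hh hS hQ).fderiv_eq, hf.fderiv]
    simp [div_eq_mul_inv]
  · rw [indicator_of_notMem hQ]
    have key (m : ℝ) (hm : |m| ≤ M) : fderiv ℝ (coneCutoff M r S h) p (0, 1)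
        + m * fderiv ℝ (coneCutoff M r S h) p (1, 0) ≤ 0 := by
      have e : ((m, 1) : ℝ × ℝ) = (0, 1) + m • (1, 0) := by simp
      have := fderiv_apply_nonpos hd (v := (m, 1))
        fun s hs => coneCutoff_add_smul_le hh hp hm hs
      rwa [e, map_add, map_smul, smul_eq_mul] at this
    have k1 := key M (abs_of_pos hM).le
    have k2 := key (-M) (by rw [abs_neg, abs_of_pos hM])
    set a := fderiv ℝ (coneCutoff M r S h) p (0, 1)
    set b := fderiv ℝ (coneCutoff M r S h) p (1, 0)
    have hv : 0 ≤ v := nonneg_of_mul_nonneg_right ((abs_nonneg _).trans hφ) hM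
    have hb : M * |b| ≤ -a := by
      rcases abs_cases b with ⟨h', -⟩ | ⟨h', -⟩ <;> rw [h'] <;> linarith
    have h1 : φ * b ≤ M * v * |b| := by
      refine (le_abs_self _).trans ?_
      rw [abs_mul]
      gcongr
    have h2 := mul_le_mul_of_nonneg_left hb hv
    linarith

lemma integrable_mul_fderiv_coneCutoff (hM : 0 < M) (hh : 0 < h) {f : ℝ × ℝ → ℝ} {B : ℝ}
    (hf : AEStronglyMeasurable f halfPlane) (hB : ∀ᵐ p ∂halfPlane, |f p| ≤ B) (v : ℝ × ℝ) :
    Integrable (fun p => f p * fderiv ℝ (coneCutoff M r S h) p v) halfPlane := by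
  obtain ⟨L, hL⟩ := exists_lipschitzWith_coneCutoff (M := M) (r := r) (S := S) (h := h) hM hh
  set K := Icc (-(r + M * (S + 1) + h)) (r + M * (S + 1) + h) ×ˢ Icc (-1) S
  have hsupp : Function.support (fun p => f p * fderiv ℝ (coneCutoff M r S h) p v) ⊆ K := by
    intro p hp
    refine tsupport_coneCutoff_subset hM hh (support_fderiv_subset ℝ ?_)
    intro h0
    simp [h0] at hp
  rw [← integrableOn_iff_integrable_of_support_subset hsupp]
  refine Measure.integrableOn_of_bounded (M := B * (L * ‖v‖))
    (isCompact_Icc.prod isCompact_Icc).measure_lt_top.ne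
    (hf.mul (measurable_fderiv_apply_const ℝ _ v).aestronglyMeasurable) (ae_restrict_of_ae ?_)
  filter_upwards [hB] with p hp
  rw [norm_mul]
  refine mul_le_mul hp ?_ (norm_nonneg _) ((abs_nonneg _).trans hp)
  exact ((fderiv ℝ _ p).le_opNorm v).trans (by gcongr; exact norm_fderiv_le_of_lipschitz ℝ hL)

end coneCutoff

lemma integrable_prod_restrict_of_bounded {f : ℝ × ℝ → ℝ} {B : ℝ}
    (hf : AEStronglyMeasurable f halfPlane) (hB : ∀ᵐ p ∂halfPlane, |f p| ≤ B)
    {s t : Set ℝ} (hs : volume s ≠ ⊤) (ht : volume t ≠ ⊤) (htm : MeasurableSet t)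
    (ht0 : t ⊆ Ioi 0) :
    Integrable f ((volume.restrict s).prod (volume.restrict t)) := by
  have e : (volume.restrict s).prod (volume.restrict t) = halfPlane.restrict (s ×ˢ t) := by
    rw [halfPlane, ← Measure.prod_restrict, Measure.restrict_restrict htm,
      inter_eq_self_of_subset_left ht0]
  rw [e]
  refine Measure.integrableOn_of_bounded (M := B) ?_ hf (ae_restrict_of_ae hB)
  rw [Measure.prod_prod]
  exact ENNReal.mul_ne_top hs
    (ne_top_of_le_ne_top ht (Measure.restrict_apply_le _ _))

/-- Kato's inequality tested against `coneCutoff`. -/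
lemma setIntegral_le_of_kato {M : ℝ} (hM : 0 < M)
    {w : ℝ → ℝ → ℝ} {w₀ : ℝ → ℝ} {Φ : ℝ → ℝ → ℝ} {B B₀ : ℝ}
    (hwmeas : AEStronglyMeasurable (fun p : ℝ × ℝ => w p.1 p.2) halfPlane)
    (hwbdd : ∀ᵐ p ∂halfPlane, |w p.1 p.2| ≤ B)
    (hw₀meas : AEMeasurable w₀)
    (hw₀bdd : ∀ᵐ x : ℝ, |w₀ x| ≤ B₀)
    (hw₀pos : ∀ᵐ x : ℝ, 0 ≤ w₀ x)
    (hΦmeas : AEStronglyMeasurable (fun p : ℝ × ℝ => Φ p.1 p.2) halfPlane)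
    (hΦ : ∀ᵐ p ∂halfPlane, |Φ p.1 p.2| ≤ M * w p.1 p.2)
    (hKato : ∀ (ψ ψx ψt : ℝ → ℝ → ℝ) (L : NNReal),
      LipschitzWith L (fun p : ℝ × ℝ => ψ p.1 p.2) →
      HasCompactSupport (fun p : ℝ × ℝ => ψ p.1 p.2) →
      (∀ x t, 0 ≤ ψ x t) →
      (∀ᵐ p : ℝ × ℝ, HasDerivAt (fun s => ψ p.1 s) (ψt p.1 p.2) p.2 ∧
        HasDerivAt (fun y => ψ y p.2) (ψx p.1 p.2) p.1) →
      0 ≤ (∫ t in Ioi (0:ℝ), ∫ x : ℝ, w x t * ψt x t)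
        + (∫ x : ℝ, w₀ x * ψ x 0)
        + (∫ t in Ioi (0:ℝ), ∫ x : ℝ, Φ x t * ψx x t))
    (r : ℝ) {T h : ℝ} (hT : 0 < T) (hh : 0 < h) :
    ∫ t in Ioo T (T + h), ∫ x in Ioo (-r) r, w x t ≤
      h * ∫ x in Icc (-(r + M * (T + h) + h)) (r + M * (T + h) + h), w₀ x := by
  set S := T + h with hS
  set g := coneCutoff M r S h with hg
  obtain ⟨L, hL⟩ := exists_lipschitzWith_coneCutoff (M := M) (r := r) (S := S) (h := h) hM hh
  have hdiff : ∀ᵐ p : ℝ × ℝ, DifferentiableAt ℝ g p := hL.ae_differentiableAt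
  have hdiff' : ∀ᵐ p ∂halfPlane, DifferentiableAt ℝ g p := by
    filter_upwards [ae_halfPlane (hdiff.mono fun p hp _ => hp)] with p hp using hp
  have hΦbdd : ∀ᵐ p ∂halfPlane, |Φ p.1 p.2| ≤ M * B := by
    filter_upwards [hΦ, hwbdd] with p h1 h2
    exact h1.trans (by gcongr; exact (le_abs_self _).trans h2)
  have hint1 := integrable_mul_fderiv_coneCutoff (r := r) (S := S) hM hh hwmeas hwbdd (0, 1)
  have hint2 := integrable_mul_fderiv_coneCutoff (r := r) (S := S) hM hh hΦmeas hΦbdd (1, 0)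
  have kato := hKato (fun x t => g (x, t)) (fun x t => fderiv ℝ g (x, t) (1, 0))
    (fun x t => fderiv ℝ g (x, t) (0, 1)) L hL (hasCompactSupport_coneCutoff hM hh)
    (fun x t => coneCutoff_nonneg _) (by
      filter_upwards [hdiff] with p hp
      constructor
      · exact hp.hasFDerivAt.comp_hasDerivAt (f := fun s => (p.1, s)) p.2
          ((hasDerivAt_const _ _).prodMk (hasDerivAt_id _))
      · exact hp.hasFDerivAt.comp_hasDerivAt (f := fun s => (s, p.2)) p.1
          ((hasDerivAt_id _).prodMk (hasDerivAt_const _ _)))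
  rw [← integral_prod_symm _ hint1, ← integral_prod_symm _ hint2] at kato
  have hQm : MeasurableSet (Ioo (-r) r ×ˢ Ioo (S - h) S) := measurableSet_Ioo.prod measurableSet_Ioo
  have hTS : S - h = T := by simp [hS]
  have hQ : halfPlane.restrict (Ioo (-r) r ×ˢ Ioo (S - h) S) =
      (volume.restrict (Ioo (-r) r)).prod (volume.restrict (Ioo T S)) := by
    rw [halfPlane, ← Measure.prod_restrict, Measure.restrict_restrict measurableSet_Ioo, hTS,
      inter_eq_self_of_subset_left]
    exact fun t ht => hT.trans ht.1
  have hwQ : Integrable (fun p : ℝ × ℝ => w p.1 p.2)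
      ((volume.restrict (Ioo (-r) r)).prod (volume.restrict (Ioo T S))) :=
    integrable_prod_restrict_of_bounded hwmeas hwbdd (by simp) (by simp) measurableSet_Ioo
      fun t ht => hT.trans ht.1
  have hwQ' : IntegrableOn (fun p : ℝ × ℝ => -(w p.1 p.2 / h)) (Ioo (-r) r ×ˢ Ioo (S - h) S)
      halfPlane := by
    rw [IntegrableOn, hQ]
    exact (hwQ.div_const h).neg
  have hflux : (∫ p, w p.1 p.2 * fderiv ℝ g p (0, 1) ∂halfPlane) +
      (∫ p, Φ p.1 p.2 * fderiv ℝ g p (1, 0) ∂halfPlane) ≤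
      -((∫ t in Ioo T S, ∫ x in Ioo (-r) r, w x t) / h) := by
    rw [← integral_add hint1 hint2]
    calc _ ≤ ∫ p, (Ioo (-r) r ×ˢ Ioo (S - h) S).indicator
          (fun p => -(w p.1 p.2 / h)) p ∂halfPlane := by
          refine integral_mono_ae (hint1.add hint2) ((integrable_indicator_iff hQm).2 hwQ') ?_
          filter_upwards [hdiff', hΦ, ae_halfPlane_pos] with p h1 h2 h3
          exact coneCutoff_flux_le hM hh (by linarith) h3 h1 h2
      _ = _ := by
          rw [integral_indicator hQm, hQ, integral_neg, integral_div, integral_prod_symm _ hwQ]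
  have hinit : ∫ x, w₀ x * g (x, 0) ≤ ∫ x in Icc (-(r + M * S + h)) (r + M * S + h), w₀ x := by
    rw [← integral_indicator measurableSet_Icc]
    refine integral_mono_of_nonneg ?_ ?_ ?_
    · filter_upwards [hw₀pos] with x hx using mul_nonneg hx (coneCutoff_nonneg _)
    · rw [integrable_indicator_iff measurableSet_Icc]
      exact Measure.integrableOn_of_bounded (M := B₀) (by simp) hw₀meas.aestronglyMeasurable
        (ae_restrict_of_ae hw₀bdd)
    · filter_upwards [hw₀pos] with x hx
      by_cases hmem : x ∈ Icc (-(r + M * S + h)) (r + M * S + h)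
      · rw [indicator_of_mem hmem]
        exact mul_le_of_le_one_right hx (coneCutoff_le_one _)
      · rw [indicator_of_notMem hmem]
        have : g (x, 0) = 0 := by
          by_contra hne
          have := (coneCutoff_ne_zero hh hne).1
          simp only [sub_zero] at this
          exact hmem (abs_le.1 this)
        simp [this]
  have : (∫ t in Ioo T S, ∫ x in Ioo (-r) r, w x t) / h ≤
      ∫ x in Icc (-(r + M * S + h)) (r + M * S + h), w₀ x := by
    change 0 ≤ (∫ p, w p.1 p.2 * fderiv ℝ g p (0, 1) ∂halfPlane) + (∫ x, w₀ x * g (x, 0)) +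
      (∫ p, Φ p.1 p.2 * fderiv ℝ g p (1, 0) ∂halfPlane) at kato
    linarith
  rwa [div_le_iff₀' hh] at this

lemma setIntegral_Icc_le_add {f : ℝ → ℝ} {B : ℝ} (hf : AEMeasurable f)
    (hB : ∀ᵐ x : ℝ, |f x| ≤ B) {a b : ℝ} (ha : 0 ≤ a) (hab : a ≤ b) :
    ∫ x in Icc (-b) b, f x ≤ (∫ x in Icc (-a) a, f x) + 2 * B * (b - a) := by
  have hi (s t : ℝ) : IntervalIntegrable f volume s t :=
    ⟨Measure.integrableOn_of_bounded (M := B) (by simp) hf.aestronglyMeasurable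
        (ae_restrict_of_ae hB),
      Measure.integrableOn_of_bounded (M := B) (by simp) hf.aestronglyMeasurable
        (ae_restrict_of_ae hB)⟩
  have hle (s t : ℝ) (hst : s ≤ t) : ∫ x in s..t, f x ≤ B * (t - s) := by
    have := intervalIntegral.norm_integral_le_of_norm_le_const_ae (a := s) (b := t) (f := f)
      (hB.mono fun x hx _ => hx)
    rw [abs_of_nonneg (sub_nonneg.2 hst)] at this
    exact (le_abs_self _).trans this
  rw [integral_Icc_eq_integral_Ioc, integral_Icc_eq_integral_Ioc,
    ← intervalIntegral.integral_of_le (by linarith), ← intervalIntegral.integral_of_le (by linarith),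
    ← intervalIntegral.integral_add_adjacent_intervals (hi (-b) (-a)) (hi (-a) b),
    ← intervalIntegral.integral_add_adjacent_intervals (hi (-a) a) (hi a b)]
  have h1 := hle (-b) (-a) (by linarith)
  have h2 := hle a b hab
  linarith

/-- One-sided Lebesgue differentiation: an upper bound on forward time averages passes to almost
every time. -/
lemma ae_le_of_setIntegral_le {F : ℝ → ℝ} {G : ℝ → ℝ → ℝ}
    (hF : ∀ a b : ℝ, 0 < a → IntegrableOn F (Ioo a b))
    (h : ∀ T ε : ℝ, 0 < T → 0 < ε → ∫ t in Ioo T (T + ε), F t ≤ ε * G T ε)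
    {g : ℝ → ℝ} (hG : ∀ T, 0 < T → Tendsto (G T) (𝓝[>] 0) (𝓝 (g T))) :
    ∀ᵐ t : ℝ, 0 < t → F t ≤ g t := by
  have key (n : ℕ) : ∀ᵐ t : ℝ, t ∈ Ioo (1 / ((n : ℝ) + 1)) (n + 1) → F t ≤ g t := by
    have hi : IntervalIntegrable F volume (1 / ((n : ℝ) + 1)) (n + 1) := by
      have hle : 1 / ((n : ℝ) + 1) ≤ n + 1 := by
        rw [div_le_iff₀ (by positivity)]
        nlinarith [n.cast_nonneg (α := ℝ)]
      rw [intervalIntegrable_iff_integrableOn_Ioo_of_le hle]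
      exact hF _ _ (by positivity)
    filter_upwards [hi.ae_hasDerivAt_integral] with t ht hmem
    have hpos : 0 < t := lt_trans (by positivity) hmem.1
    have hd := ht (Icc_subset_uIcc (Ioo_subset_Icc_self hmem)) t
      (Icc_subset_uIcc (Ioo_subset_Icc_self hmem))
    refine le_of_tendsto_of_tendsto hd.tendsto_slope_zero_right (hG t hpos) ?_
    filter_upwards [self_mem_nhdsWithin] with ε hε
    have hε' : (0 : ℝ) < ε := hε
    rw [intervalIntegral.integral_same, sub_zero, smul_eq_mul, inv_mul_le_iff₀ hε',
      intervalIntegral.integral_of_le (by linarith), integral_Ioc_eq_integral_Ioo]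
    exact h t ε hpos hε'
  filter_upwards [ae_all_iff.2 key] with t ht hpos
  obtain ⟨n, hn⟩ := exists_nat_gt (max t (1 / t))
  have h1 : t < n := (le_max_left _ _).trans_lt hn
  have h2 : 1 / t < n := (le_max_right _ _).trans_lt hn
  refine ht n ⟨?_, by linarith⟩
  rw [one_div_lt (by positivity) hpos]
  linarith

/-- A Kato-type inequality for a nonnegative quantity `w` with flux `Φ` dominated by
`M w` implies the `L¹` contraction estimate with finite speed of propagation `M`:
`∫_{-R}^R w(·,t) ≤ ∫_{-R-Mt}^{R+Mt} w₀` for a.e. `t > 0` and every `R > 0`. -/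
theorem stmt17 (M : ℝ) (hM : 0 < M)
    (w : ℝ → ℝ → ℝ) (w₀ : ℝ → ℝ) (Φ : ℝ → ℝ → ℝ)
    (hwmeas : AEMeasurable (fun p : ℝ × ℝ => w p.1 p.2))
    (hwbdd : ∃ B : ℝ, ∀ᵐ p : ℝ × ℝ, 0 < p.2 → |w p.1 p.2| ≤ B)
    (hwpos : ∀ᵐ p : ℝ × ℝ, 0 < p.2 → 0 ≤ w p.1 p.2)
    (hw₀meas : AEMeasurable w₀)
    (hw₀bdd : ∃ B : ℝ, ∀ᵐ x : ℝ, |w₀ x| ≤ B)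
    (hw₀pos : ∀ᵐ x : ℝ, 0 ≤ w₀ x)
    (hΦmeas : AEMeasurable (fun p : ℝ × ℝ => Φ p.1 p.2))
    (hΦ : ∀ᵐ p : ℝ × ℝ, 0 < p.2 → |Φ p.1 p.2| ≤ M * w p.1 p.2)
    -- Kato inequality against nonnegative compactly supported Lipschitz test functions,
    -- whose a.e. partial derivatives are `ψx`, `ψt`
    (hKato : ∀ (ψ ψx ψt : ℝ → ℝ → ℝ) (L : NNReal),
      LipschitzWith L (fun p : ℝ × ℝ => ψ p.1 p.2) →
      HasCompactSupport (fun p : ℝ × ℝ => ψ p.1 p.2) →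
      (∀ x t, 0 ≤ ψ x t) →
      (∀ᵐ p : ℝ × ℝ, HasDerivAt (fun s => ψ p.1 s) (ψt p.1 p.2) p.2 ∧
        HasDerivAt (fun y => ψ y p.2) (ψx p.1 p.2) p.1) →
      0 ≤ (∫ t in Ioi (0:ℝ), ∫ x : ℝ, w x t * ψt x t)
        + (∫ x : ℝ, w₀ x * ψ x 0)
        + (∫ t in Ioi (0:ℝ), ∫ x : ℝ, Φ x t * ψx x t)) :
    ∀ᵐ t : ℝ, 0 < t → ∀ R : ℝ, 0 < R →
      (∫ x in Icc (-R) R, w x t) ≤ ∫ x in Icc (-R - M * t) (R + M * t), w₀ x := by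
  obtain ⟨B, hwB⟩ := hwbdd
  obtain ⟨B₀, hw₀B⟩ := hw₀bdd
  have hac : halfPlane ≪ (volume : Measure (ℝ × ℝ)) := by
    rw [halfPlane_eq_restrict]
    exact Measure.absolutelyContinuous_of_le Measure.restrict_le_self
  have hwm := (hwmeas.mono_ac hac).aestronglyMeasurable
  have hwB' := ae_halfPlane hwB
  have hslice : ∀ᵐ t : ℝ, 0 < t → ∀ᵐ x : ℝ, 0 ≤ w x t := by
    have h1 : ∀ᵐ p : ℝ × ℝ ∂((volume : Measure ℝ).prod volume), 0 < p.2 → 0 ≤ w p.1 p.2 := hwpos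
    have h2 := Measure.ae_ae_of_ae_prod (Measure.measurePreserving_swap
      (μ := (volume : Measure ℝ)) (ν := (volume : Measure ℝ)) |>.quasiMeasurePreserving.ae h1)
    filter_upwards [h2] with t ht hpos
    filter_upwards [ht] with x hx using hx hpos
  have hcone (r : ℚ) (hr : 0 < r) : ∀ᵐ t : ℝ, 0 < t →
      (∫ x in Ioo (-(r : ℝ)) r, w x t) ≤ ∫ x in Icc (-(r + M * t)) (r + M * t), w₀ x := by
    have hr' : (0 : ℝ) < r := by exact_mod_cast hr
    refine ae_le_of_setIntegral_le
      (G := fun T ε => (∫ x in Icc (-(r + M * T)) (r + M * T), w₀ x) + 2 * B₀ * ((M + 1) * ε))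
      (fun a b ha => ?_) (fun T ε hT hε => ?_) (fun T hT => ?_)
    · exact (integrable_prod_restrict_of_bounded hwm hwB' (s := Ioo (-(r : ℝ)) r) (by simp)
        (by simp) measurableSet_Ioo fun t ht => ha.trans ht.1).integral_prod_right
    · refine (setIntegral_le_of_kato hM hwm hwB' hw₀meas hw₀B hw₀pos
        (hΦmeas.mono_ac hac).aestronglyMeasurable (ae_halfPlane hΦ) hKato r hT hε).trans ?_
      gcongr
      have hMT := mul_pos hM hT
      have hMε := mul_pos hM hε
      refine (setIntegral_Icc_le_add hw₀meas hw₀B (a := r + M * T) (by positivity)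
        (by linarith)).trans_eq ?_
      ring
    · have : Continuous fun ε : ℝ =>
          (∫ x in Icc (-(r + M * T)) (r + M * T), w₀ x) + 2 * B₀ * ((M + 1) * ε) := by fun_prop
      simpa using (this.tendsto 0).mono_left nhdsWithin_le_nhds
  have hint (r : ℚ) : ∀ᵐ t : ℝ, 0 < t → IntegrableOn (fun x => w x t) (Ioo (-(r : ℝ)) r) := by
    have key (n : ℕ) : ∀ᵐ t : ℝ, t ∈ Ioo (0 : ℝ) n →
        IntegrableOn (fun x => w x t) (Ioo (-(r : ℝ)) r) := by
      rw [← ae_restrict_iff' measurableSet_Ioo]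
      exact (integrable_prod_restrict_of_bounded hwm hwB' (s := Ioo (-(r : ℝ)) r) (by simp)
        (by simp) measurableSet_Ioo fun t ht => ht.1).prod_left_ae
    filter_upwards [ae_all_iff.2 key] with t ht hpos
    obtain ⟨n, hn⟩ := exists_nat_gt t
    exact ht n ⟨hpos, hn⟩
  have hcone' : ∀ᵐ t : ℝ, ∀ r : ℚ, 0 < r → 0 < t →
      (∫ x in Ioo (-(r : ℝ)) r, w x t) ≤ ∫ x in Icc (-(r + M * t)) (r + M * t), w₀ x := by
    refine ae_all_iff.2 fun r => ?_
    by_cases hr : 0 < r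
    · filter_upwards [hcone r hr] with t ht _ using ht
    · exact Eventually.of_forall fun t h => absurd h hr
  filter_upwards [hcone', ae_all_iff.2 hint, hslice] with t hc hi hs ht R hR
  have hMt := mul_pos hM ht
  have hB₀ : 0 ≤ B₀ := by
    obtain ⟨x, hx⟩ := hw₀B.exists
    exact (abs_nonneg _).trans hx
  rw [show -R - M * t = -(R + M * t) by ring]
  refine le_of_forall_pos_le_add fun δ hδ => ?_
  obtain ⟨r, hr1, hr2⟩ := exists_rat_btwn
    (lt_add_of_pos_right R (show 0 < δ / (2 * B₀ + 1) by positivity))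
  have hr0 : 0 < r := by exact_mod_cast hR.trans hr1
  calc ∫ x in Icc (-R) R, w x t ≤ ∫ x in Ioo (-(r : ℝ)) r, w x t :=
        setIntegral_mono_set (hi r ht) (ae_restrict_of_ae (hs ht))
          (Icc_subset_Ioo (by linarith) hr1).eventuallyLE
    _ ≤ ∫ x in Icc (-(r + M * t)) (r + M * t), w₀ x := hc r hr0 ht
    _ ≤ (∫ x in Icc (-(R + M * t)) (R + M * t), w₀ x) + 2 * B₀ * ((r + M * t) - (R + M * t)) :=
        setIntegral_Icc_le_add hw₀meas hw₀B (by positivity) (by linarith)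
    _ ≤ _ := by
        gcongr
        have h1 : (r : ℝ) - R ≤ δ / (2 * B₀ + 1) := by linarith
        rw [le_div_iff₀ (by positivity)] at h1
        linarith
end
end
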